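/- arXiv:0708.2754 — 2 statements merged into one kernel-verified Lean document; each statement's English description precedes it below -/
import Mathlib

section
/- (Universal variance bound for linear statistics of zeros; one-variable case of Lemma 3.3 / Theorem 1.1 with k = 1.) There is a constant C > 0 such that for every n ≥ 1, every tuple of polynomials p_1, …, p_n ∈ ℂ[z] not all zero, and every smooth compactly supported function φ : ℂ → ℝ, the random variable X(c) := ∑_{a ∈ Z(f_c)} φ(a), where f_c = ∑_{j=1}^n c_j p_j and c is distributed according to γ_n, satisfies Var(X) ≤ C · ( ∫_ℂ |Δφ(z)| dλ(z) )². The constant C is independent of n, of the polynomials p_j, and of φ. -/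
open MeasureTheory

noncomputable instance (n : ℕ) : MeasurableSpace (EuclideanSpace ℂ (Fin n)) := borel _
instance (n : ℕ) : BorelSpace (EuclideanSpace ℂ (Fin n)) := ⟨rfl⟩

/-- The standard complex Gaussian measure `γₙ` on `ℂⁿ`, with density
`c ↦ π⁻ⁿ exp(-‖c‖²)` with respect to Lebesgue measure on `ℂⁿ ≅ ℝ²ⁿ`. -/
noncomputable def gammaC (n : ℕ) : Measure (EuclideanSpace ℂ (Fin n)) :=
  volume.withDensity fun c => ENNReal.ofReal ((Real.pi ^ n)⁻¹ * Real.exp (-‖c‖ ^ 2))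


/-- The Laplacian `Δφ = ∂²φ/∂x² + ∂²φ/∂y²` of a function `φ : ℂ → ℝ`. -/
noncomputable def lap (φ : ℂ → ℝ) (z : ℂ) : ℝ :=
  iteratedFDeriv ℝ 2 φ z ![1, 1] + iteratedFDeriv ℝ 2 φ z ![Complex.I, Complex.I]


section Laplacian

variable {φ : ℂ → ℝ}

theorem lap_eq_fderiv (φ : ℂ → ℝ) (z : ℂ) :
    lap φ z = fderiv ℝ (fderiv ℝ φ) z 1 1 + fderiv ℝ (fderiv ℝ φ) z Complex.I Complex.I := by
  simp [lap, iteratedFDeriv_two_apply]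

theorem contDiff_fderiv (hφ : ContDiff ℝ (⊤ : ℕ∞) φ) : ContDiff ℝ (⊤ : ℕ∞) (fderiv ℝ φ) :=
  hφ.fderiv_right (by simp)

theorem continuous_fderiv_fderiv (hφ : ContDiff ℝ (⊤ : ℕ∞) φ) :
    Continuous (fderiv ℝ (fderiv ℝ φ)) :=
  (contDiff_fderiv hφ).continuous_fderiv (by simp)

theorem continuous_lap (hφ : ContDiff ℝ (⊤ : ℕ∞) φ) : Continuous (lap φ) := by
  have h := continuous_fderiv_fderiv hφ
  simp_rw [funext (lap_eq_fderiv φ)]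
  fun_prop

theorem hasCompactSupport_lap (hφ : HasCompactSupport φ) : HasCompactSupport (lap φ) := by
  have h := (hφ.fderiv ℝ).fderiv ℝ
  refine h.mono fun z hz => ?_
  contrapose! hz
  simp only [Function.mem_support, not_not] at hz
  simp [lap_eq_fderiv, hz]

theorem integrable_lap (hφ : ContDiff ℝ (⊤ : ℕ∞) φ) (hc : HasCompactSupport φ) :
    Integrable (lap φ) :=
  (continuous_lap hφ).integrable_of_hasCompactSupport (hasCompactSupport_lap hc)

theorem lap_comp_add_right (φ : ℂ → ℝ) (a z : ℂ) :
    lap (fun w => φ (w + a)) z = lap φ (z + a) := by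
  simp only [lap, iteratedFDeriv_comp_add_right]

/-- The Laplacian may be computed in any rotated frame `(x + y i, -y + x i)`. -/
theorem lap_eq_rotated (φ : ℂ → ℝ) (z : ℂ) {x y : ℝ} (h : x ^ 2 + y ^ 2 = 1) :
    lap φ z = fderiv ℝ (fderiv ℝ φ) z (x + y * Complex.I) (x + y * Complex.I)
      + fderiv ℝ (fderiv ℝ φ) z (-y + x * Complex.I) (-y + x * Complex.I) := by
  have h1 : (x + y * Complex.I : ℂ) = x • (1 : ℂ) + y • Complex.I := by simp
  have h2 : (-y + x * Complex.I : ℂ) = (-y) • (1 : ℂ) + x • Complex.I := by simp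
  rw [h1, h2, lap_eq_fderiv]
  simp only [map_add, map_smul, add_apply, smul_apply, smul_eq_mul]
  linear_combination (-(fderiv ℝ (fderiv ℝ φ) z 1 1)
    - fderiv ℝ (fderiv ℝ φ) z Complex.I Complex.I) * h

theorem integral_fderiv_apply_eq_zero {g : ℂ → ℝ} (hg : ContDiff ℝ (⊤ : ℕ∞) g)
    (hc : HasCompactSupport g) (v : ℂ) : ∫ z, fderiv ℝ g z v = 0 := by
  have hd : Continuous (fun z => fderiv ℝ g z v) :=
    (hg.continuous_fderiv (by simp)).clm_apply continuous_const
  have hs : HasCompactSupport (fun z => fderiv ℝ g z v) := hc.fderiv_apply ℝ v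
  have h := integral_mul_fderiv_eq_neg_fderiv_mul_of_integrable (μ := volume) (f := fun _ : ℂ => (1 : ℝ))
    (g := g) (v := v) (by simp) (by simpa using hd.integrable_of_hasCompactSupport hs)
    (by simpa using hg.continuous.integrable_of_hasCompactSupport hc) (by simp)
    (fun z _ => hg.differentiable (by simp) z)
  simpa using h

theorem integral_lap_eq_zero (hφ : ContDiff ℝ (⊤ : ℕ∞) φ) (hc : HasCompactSupport φ) :
    ∫ z, lap φ z = 0 := by
  have key (v : ℂ) : (fun z => fderiv ℝ (fderiv ℝ φ) z v v)
      = fun z => fderiv ℝ (fun w => fderiv ℝ φ w v) z v := by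
    funext z
    rw [fderiv_clm_apply ((contDiff_fderiv hφ).differentiable (by simp) z) (by simp)]
    simp
  have hs (v : ℂ) : ContDiff ℝ (⊤ : ℕ∞) (fun w => fderiv ℝ φ w v) :=
    (contDiff_fderiv hφ).clm_apply contDiff_const
  have hi (v : ℂ) : Integrable (fun z => fderiv ℝ (fderiv ℝ φ) z v v) :=
    (((continuous_fderiv_fderiv hφ).clm_apply continuous_const).clm_apply
      continuous_const).integrable_of_hasCompactSupport
      (by rw [key]; exact (hc.fderiv_apply ℝ v).fderiv_apply ℝ v)
  simp_rw [lap_eq_fderiv]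
  rw [integral_add (hi _) (hi _), key, key,
    integral_fderiv_apply_eq_zero (hs _) (hc.fderiv_apply ℝ _),
    integral_fderiv_apply_eq_zero (hs _) (hc.fderiv_apply ℝ _), add_zero]

end Laplacian

section Logarithm

theorem integrableOn_log_mul_of_continuous {F : ℝ → ℝ} (hF : Continuous F) {R : ℝ}
    (hR : ∀ r, R < r → F r = 0) : IntegrableOn (fun r => Real.log r * F r) (Set.Ioi 0) := by
  have h : IntegrableOn (fun r => Real.log r * F r) (Set.Ioc 0 (max R 0)) := by
    have hl : IntervalIntegrable Real.log volume 0 (max R 0) :=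
      intervalIntegral.intervalIntegrable_log'
    exact (intervalIntegrable_iff_integrableOn_Ioc_of_le (le_max_right _ _)).1
      (hl.mul_continuousOn hF.continuousOn)
  refine h.of_forall_sdiff_eq_zero measurableSet_Ioi fun r hr => ?_
  have : R < r := by
    by_contra! hle
    exact hr.2 ⟨hr.1, hle.trans (le_max_left _ _)⟩
  simp [hR r this]

theorem integrableOn_log_fst_mul_of_continuous {F : ℝ × ℝ → ℝ} (hF : Continuous F) {R : ℝ}
    (hR : ∀ p : ℝ × ℝ, R < p.1 → F p = 0) (a b : ℝ) :
    IntegrableOn (fun p : ℝ × ℝ => Real.log p.1 * F p) (Set.Ioi 0 ×ˢ Set.Ioo a b) := by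
  have h : IntegrableOn (fun p : ℝ × ℝ => Real.log p.1 * F p)
      (Set.Ioc 0 (max R 0) ×ˢ Set.Ioo a b) := by
    have hl : IntervalIntegrable Real.log volume 0 (max R 0) :=
      intervalIntegral.intervalIntegrable_log'
    have hl' := (intervalIntegrable_iff_integrableOn_Ioc_of_le (le_max_right _ _)).1 hl
    have h1 : IntegrableOn (fun _ : ℝ => (1 : ℝ)) (Set.Ioo a b) := by simp
    have h2 := Integrable.mul_prod hl' h1
    rw [Measure.prod_restrict] at h2
    obtain ⟨K, hK⟩ := (isCompact_Icc.prod isCompact_Icc :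
      IsCompact (Set.Icc 0 (max R 0) ×ˢ Set.Icc a b)).exists_bound_of_continuousOn hF.continuousOn
    have h3 := Integrable.bdd_mul (c := K) h2 hF.aestronglyMeasurable ((ae_restrict_iff'
      (measurableSet_Ioc.prod measurableSet_Ioo)).2 (.of_forall fun p hp =>
        hK p ⟨Set.Ioc_subset_Icc_self hp.1, Set.Ioo_subset_Icc_self hp.2⟩))
    refine Integrable.congr h3 (.of_forall fun p => ?_)
    simp [mul_comm]
  refine h.of_forall_sdiff_eq_zero (measurableSet_Ioi.prod measurableSet_Ioo) fun p hp => ?_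
  have : R < p.1 := by
    by_contra! hle
    exact hp.2 ⟨⟨hp.1.1, hle.trans (le_max_left _ _)⟩, hp.1.2⟩
  simp [hR p this]

end Logarithm

section FundamentalSolution

variable {φ : ℂ → ℝ}

/-- The unit vector `cos θ + i sin θ`. -/
noncomputable def unitVec (θ : ℝ) : ℂ := Real.cos θ + Real.sin θ * Complex.I

/-- The unit vector `-sin θ + i cos θ`, orthogonal to `unitVec θ`. -/
noncomputable def unitVecPerp (θ : ℝ) : ℂ := -Real.sin θ + Real.cos θ * Complex.I

theorem continuous_unitVec : Continuous unitVec := by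
  unfold unitVec; fun_prop

theorem continuous_unitVecPerp : Continuous unitVecPerp := by
  unfold unitVecPerp; fun_prop

theorem norm_unitVec (θ : ℝ) : ‖unitVec θ‖ = 1 := by
  unfold unitVec
  push_cast
  rw [← Complex.exp_mul_I, Complex.norm_exp_ofReal_mul_I]

theorem hasDerivAt_unitVec (θ : ℝ) : HasDerivAt unitVec (unitVecPerp θ) θ := by
  have h1 := (Real.hasDerivAt_cos θ).ofReal_comp
  have h2 := (Real.hasDerivAt_sin θ).ofReal_comp
  refine (h1.add (h2.mul_const Complex.I)).congr_deriv ?_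
  simp [unitVecPerp]

theorem hasDerivAt_unitVecPerp (θ : ℝ) : HasDerivAt unitVecPerp (-unitVec θ) θ := by
  have h1 := (Real.hasDerivAt_cos θ).ofReal_comp
  have h2 := (Real.hasDerivAt_sin θ).ofReal_comp
  refine (h2.neg.add (h1.mul_const Complex.I)).congr_deriv ?_
  simp [unitVec]
  ring

/-- `∂ᵣ (r ∂ᵣ φ)` in polar coordinates `p = (r, θ)`. -/
noncomputable def radialPart (φ : ℂ → ℝ) (p : ℝ × ℝ) : ℝ :=
  p.1 * fderiv ℝ (fderiv ℝ φ) (p.1 * unitVec p.2) (unitVec p.2) (unitVec p.2)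
    + fderiv ℝ φ (p.1 * unitVec p.2) (unitVec p.2)

/-- `r⁻¹ ∂²φ/∂θ²` in polar coordinates `p = (r, θ)`. -/
noncomputable def angularPart (φ : ℂ → ℝ) (p : ℝ × ℝ) : ℝ :=
  p.1 * fderiv ℝ (fderiv ℝ φ) (p.1 * unitVec p.2) (unitVecPerp p.2) (unitVecPerp p.2)
    - fderiv ℝ φ (p.1 * unitVec p.2) (unitVec p.2)

theorem radialPart_add_angularPart (φ : ℂ → ℝ) (p : ℝ × ℝ) :
    radialPart φ p + angularPart φ p = p.1 * lap φ (p.1 * unitVec p.2) := by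
  rw [lap_eq_rotated φ _ (Real.cos_sq_add_sin_sq p.2)]
  simp only [radialPart, angularPart, unitVec, unitVecPerp]
  ring

theorem continuous_radialPart (hφ : ContDiff ℝ (⊤ : ℕ∞) φ) : Continuous (radialPart φ) := by
  have h1 := continuous_fderiv_fderiv hφ
  have h2 := (contDiff_fderiv hφ).continuous
  have h3 := continuous_unitVec
  unfold radialPart
  fun_prop

theorem continuous_angularPart (hφ : ContDiff ℝ (⊤ : ℕ∞) φ) : Continuous (angularPart φ) := by
  have h1 := continuous_fderiv_fderiv hφ
  have h2 := (contDiff_fderiv hφ).continuous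
  have h3 := continuous_unitVec
  have h4 := continuous_unitVecPerp
  unfold angularPart
  fun_prop

theorem exists_radius_fderiv_eq_zero (hc : HasCompactSupport φ) :
    ∃ R : ℝ, 0 < R ∧ ∀ z : ℂ, R < ‖z‖ →
      φ z = 0 ∧ fderiv ℝ φ z = 0 ∧ fderiv ℝ (fderiv ℝ φ) z = 0 := by
  obtain ⟨R, hR0, hR⟩ := hc.isCompact.isBounded.subset_closedBall_lt 0 0
  refine ⟨R, hR0, fun z hz => ?_⟩
  have hz' : z ∉ tsupport φ := fun h => by
    have := hR h
    simp at this
    linarith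
  have h2 : z ∉ tsupport (fderiv ℝ φ) := fun h => hz' (tsupport_fderiv_subset ℝ h)
  have h3 : z ∉ tsupport (fderiv ℝ (fderiv ℝ φ)) := fun h => h2 (tsupport_fderiv_subset ℝ h)
  exact ⟨image_eq_zero_of_notMem_tsupport hz', image_eq_zero_of_notMem_tsupport h2,
    image_eq_zero_of_notMem_tsupport h3⟩

theorem norm_ofReal_mul_unitVec (r θ : ℝ) : ‖(r : ℂ) * unitVec θ‖ = |r| := by
  simp [norm_unitVec]

theorem hasDerivAt_ray (r θ : ℝ) :
    HasDerivAt (fun r : ℝ => (r : ℂ) * unitVec θ) (unitVec θ) r := by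
  simpa using (Complex.ofRealCLM.hasDerivAt (x := r)).mul_const (unitVec θ)

theorem hasDerivAt_circle (r θ : ℝ) :
    HasDerivAt (fun θ : ℝ => (r : ℂ) * unitVec θ) (r * unitVecPerp θ) θ :=
  (hasDerivAt_unitVec θ).const_mul _

theorem hasDerivAt_comp_ray (hφ : ContDiff ℝ (⊤ : ℕ∞) φ) (r θ : ℝ) :
    HasDerivAt (fun r : ℝ => φ (r * unitVec θ)) (fderiv ℝ φ (r * unitVec θ) (unitVec θ)) r :=
  ((hφ.differentiable (by simp) _).hasFDerivAt).comp_hasDerivAt r (hasDerivAt_ray r θ)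

theorem hasDerivAt_mul_radial_deriv (hφ : ContDiff ℝ (⊤ : ℕ∞) φ) (r θ : ℝ) :
    HasDerivAt (fun r : ℝ => r * fderiv ℝ φ (r * unitVec θ) (unitVec θ))
      (radialPart φ (r, θ)) r := by
  have h1 := (((contDiff_fderiv hφ).differentiable (by simp)
    (r * unitVec θ)).hasFDerivAt).comp_hasDerivAt r (hasDerivAt_ray r θ)
  have h2 := h1.clm_apply (hasDerivAt_const r (unitVec θ))
  refine ((hasDerivAt_id r).mul h2).congr_deriv ?_
  simp [radialPart]
  ring

theorem hasDerivAt_angular_deriv (hφ : ContDiff ℝ (⊤ : ℕ∞) φ) (r θ : ℝ) :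
    HasDerivAt (fun θ : ℝ => fderiv ℝ φ (r * unitVec θ) (unitVecPerp θ))
      (angularPart φ (r, θ)) θ := by
  have h1 := (((contDiff_fderiv hφ).differentiable (by simp)
    (r * unitVec θ)).hasFDerivAt).comp_hasDerivAt θ (hasDerivAt_circle r θ)
  refine (h1.clm_apply (hasDerivAt_unitVecPerp θ)).congr_deriv ?_
  have h3 : (r : ℂ) * unitVecPerp θ = r • unitVecPerp θ := by simp
  simp only [angularPart, h3, map_smul, map_neg, smul_apply, smul_eq_mul,
    Function.comp]
  ring

theorem integral_angularPart (hφ : ContDiff ℝ (⊤ : ℕ∞) φ) (r : ℝ) :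
    ∫ θ in Set.Ioo (-Real.pi) Real.pi, angularPart φ (r, θ) = 0 := by
  rw [← integral_Ioc_eq_integral_Ioo,
    ← intervalIntegral.integral_of_le (by linarith [Real.pi_pos]),
    intervalIntegral.integral_eq_sub_of_hasDerivAt
      (fun θ _ => hasDerivAt_angular_deriv hφ r θ)
      (((continuous_angularPart hφ).comp (by fun_prop)).intervalIntegrable _ _)]
  simp [unitVec, unitVecPerp]

theorem integral_log_mul_radialPart (hφ : ContDiff ℝ (⊤ : ℕ∞) φ) (hc : HasCompactSupport φ)
    (θ : ℝ) : ∫ r in Set.Ioi (0 : ℝ), Real.log r * radialPart φ (r, θ) = φ 0 := by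
  obtain ⟨R, hR0, hR⟩ := exists_radius_fderiv_eq_zero hc
  have hray (r : ℝ) (hr : R < r) : R < ‖(r : ℂ) * unitVec θ‖ := by
    rw [norm_ofReal_mul_unitVec]; exact hr.trans_le (le_abs_self r)
  set g : ℝ → ℝ := fun r => fderiv ℝ φ (r * unitVec θ) (unitVec θ) with hg
  have hgc : Continuous g := by
    have h2 := (contDiff_fderiv hφ).continuous
    fun_prop
  have hg0 (r : ℝ) (hr : R < r) : g r = 0 := by simp [hg, (hR _ (hray r hr)).2.1]
  have hgi : IntegrableOn g (Set.Ioi 0) := by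
    have h : IntegrableOn g (Set.Icc 0 R) := hgc.continuousOn.integrableOn_Icc
    refine h.of_forall_sdiff_eq_zero measurableSet_Ioi fun r hr => hg0 r ?_
    by_contra! hle
    exact hr.2 ⟨le_of_lt hr.1, hle⟩
  have hgint : ∫ r in Set.Ioi (0 : ℝ), g r = - φ 0 := by
    have := integral_Ioi_of_hasDerivAt_of_tendsto (a := (0 : ℝ)) (m := 0)
      (f := fun r : ℝ => φ (r * unitVec θ)) (f' := g)
      (hasDerivAt_comp_ray hφ 0 θ).continuousAt.continuousWithinAt
      (fun r _ => hasDerivAt_comp_ray hφ r θ) hgi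
      (tendsto_const_nhds.congr' (by
        filter_upwards [Filter.eventually_gt_atTop R] with r hr using (hR _ (hray r hr)).1.symm))
    simpa using this
  have heq : Set.EqOn ((fun r : ℝ => r⁻¹) * fun r => r * g r) g (Set.Ioi 0) := fun r hr => by
    have : r ≠ 0 := ne_of_gt hr
    simp [this]
  have hlim : (Real.log * fun r => r * g r) = fun r => (r * Real.log r) * g r := by
    funext r; simp only [Pi.mul_apply]; ring
  have := integral_Ioi_mul_deriv_eq_deriv_mul (a := (0 : ℝ)) (a' := (0 : ℝ)) (b' := 0)
    (u := Real.log) (v := fun r => r * g r) (u' := fun r => r⁻¹)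
    (v' := fun r => radialPart φ (r, θ)) (fun r hr => Real.hasDerivAt_log (ne_of_gt hr))
    (fun r _ => hasDerivAt_mul_radial_deriv hφ r θ)
    (integrableOn_log_mul_of_continuous ((continuous_radialPart hφ).comp (by fun_prop))
      (R := R) fun r hr => by simp [radialPart, hR _ (hray r hr)])
    (hgi.congr_fun heq.symm measurableSet_Ioi)
    (by
      rw [hlim]
      have h : Filter.Tendsto (fun r => r * Real.log r * g r) (nhds 0)
          (nhds (0 * Real.log 0 * g 0)) := (Real.continuous_mul_log.mul hgc).tendsto 0
      rw [zero_mul, zero_mul] at h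
      exact h.mono_left nhdsWithin_le_nhds)
    (tendsto_const_nhds.congr' (by
        filter_upwards [Filter.eventually_gt_atTop R] with r hr
        simp [hg0 r hr]))
  have hcongr := setIntegral_congr_fun (μ := volume) measurableSet_Ioi heq
  simp only [Pi.mul_apply] at hcongr
  rw [this, hcongr, hgint]
  ring

theorem integral_lap_mul_log_norm (hφ : ContDiff ℝ (⊤ : ℕ∞) φ) (hc : HasCompactSupport φ) :
    ∫ z, lap φ z * Real.log ‖z‖ = 2 * Real.pi * φ 0 := by
  obtain ⟨R, hR0, hR⟩ := exists_radius_fderiv_eq_zero hc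
  have hray (p : ℝ × ℝ) (hr : R < p.1) : R < ‖(p.1 : ℂ) * unitVec p.2‖ := by
    rw [norm_ofReal_mul_unitVec]; exact hr.trans_le (le_abs_self _)
  have hA := integrableOn_log_fst_mul_of_continuous (continuous_radialPart hφ) (R := R)
    (fun p hp => by simp [radialPart, hR _ (hray p hp)]) (-Real.pi) Real.pi
  have hB := integrableOn_log_fst_mul_of_continuous (continuous_angularPart hφ) (R := R)
    (fun p hp => by simp [angularPart, hR _ (hray p hp)]) (-Real.pi) Real.pi
  have hm : MeasurableSet (Set.Ioi (0 : ℝ) ×ˢ Set.Ioo (-Real.pi) Real.pi) :=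
    measurableSet_Ioi.prod measurableSet_Ioo
  rw [← Complex.integral_comp_polarCoord_symm, polarCoord_target]
  have hsplit : Set.EqOn
      (fun p : ℝ × ℝ => p.1 • (lap φ (Complex.polarCoord.symm p)
        * Real.log ‖Complex.polarCoord.symm p‖))
      (fun p => Real.log p.1 * radialPart φ p + Real.log p.1 * angularPart φ p)
      (Set.Ioi (0 : ℝ) ×ˢ Set.Ioo (-Real.pi) Real.pi) := fun p hp => by
    have hsym : Complex.polarCoord.symm p = p.1 * unitVec p.2 := by
      simp [Complex.polarCoord_symm_apply, unitVec]
    have hp1 : (0 : ℝ) < p.1 := hp.1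
    simp only [hsym, norm_ofReal_mul_unitVec, abs_of_pos hp1, smul_eq_mul]
    rw [← mul_add, radialPart_add_angularPart]
    ring
  rw [setIntegral_congr_fun hm hsplit, integral_add hA hB]
  have h1 : ∫ p in Set.Ioi (0 : ℝ) ×ˢ Set.Ioo (-Real.pi) Real.pi,
      Real.log p.1 * radialPart φ p = 2 * Real.pi * φ 0 := by
    rw [Measure.volume_eq_prod, IntegrableOn, ← Measure.prod_restrict] at hA
    rw [Measure.volume_eq_prod, ← Measure.prod_restrict, integral_prod_symm _ hA]
    simp only [integral_log_mul_radialPart hφ hc, integral_const, smul_eq_mul]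
    congr 1
    simp [Measure.real, Real.volume_Ioo]
    rw [ENNReal.toReal_ofReal (by positivity)]
    ring
  have h2 : ∫ p in Set.Ioi (0 : ℝ) ×ˢ Set.Ioo (-Real.pi) Real.pi,
      Real.log p.1 * angularPart φ p = 0 := by
    rw [Measure.volume_eq_prod] at hB ⊢
    rw [setIntegral_prod _ hB]
    simp only [integral_const_mul, integral_angularPart hφ, mul_zero, integral_zero]
  rw [h1, h2, add_zero]

theorem integral_lap_mul_log_norm_sub (hφ : ContDiff ℝ (⊤ : ℕ∞) φ) (hc : HasCompactSupport φ)
    (a : ℂ) : ∫ z, lap φ z * Real.log ‖z - a‖ = 2 * Real.pi * φ a := by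
  have h := integral_lap_mul_log_norm (φ := fun z => φ (z + a)) (by fun_prop)
    (hc.comp_homeomorph (Homeomorph.addRight a))
  rw [zero_add] at h
  rw [← h, ← integral_add_right_eq_self _ a]
  simp [lap_comp_add_right]

end FundamentalSolution

section Roots

variable {φ : ℂ → ℝ}

theorem integrable_lap_mul_log_norm (hφ : ContDiff ℝ (⊤ : ℕ∞) φ) (hc : HasCompactSupport φ) :
    Integrable (fun z => lap φ z * Real.log ‖z‖) := by
  obtain ⟨R, -, hR⟩ := exists_radius_fderiv_eq_zero hc
  obtain ⟨K, hK⟩ := (continuous_lap hφ).bounded_above_of_compact_support (hasCompactSupport_lap hc)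
  set χ : ℝ → ℝ := fun r => max (R + 1 - r) 0 with hχ
  have hχc : Continuous χ := by fun_prop
  have hg : Integrable (fun z : ℂ => Real.log ‖z‖ * χ ‖z‖) := by
    rw [integrable_fun_norm_addHaar volume (f := fun r => Real.log r * χ r)]
    refine (integrableOn_log_mul_of_continuous (continuous_id.mul hχc) (R := R + 1)
      fun r hr => ?_).congr_fun (fun r _ => ?_) measurableSet_Ioi
    · have : χ r = 0 := max_eq_right (by linarith)
      simp [this]
    · simp [Complex.finrank_real_complex]; ring
  refine (hg.norm.const_mul K).mono' ?_ (.of_forall fun z => ?_)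
  · exact (continuous_lap hφ).aestronglyMeasurable.mul
      (Real.measurable_log.comp measurable_norm).aestronglyMeasurable
  · rw [norm_mul, norm_mul]
    rcases le_or_gt ‖z‖ R with h | h
    · have h1 : 1 ≤ ‖χ ‖z‖‖ :=
        (le_max_of_le_left (by linarith)).trans (le_abs_self _)
      have h2 : 0 ≤ ‖Real.log ‖z‖‖ := norm_nonneg _
      calc ‖lap φ z‖ * ‖Real.log ‖z‖‖ ≤ K * ‖Real.log ‖z‖‖ := by gcongr; exact hK z
        _ ≤ K * (‖Real.log ‖z‖‖ * ‖χ ‖z‖‖) := by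
          have := (norm_nonneg _).trans (hK z)
          gcongr
          exact le_mul_of_one_le_right h2 h1
    · have h0 : lap φ z = 0 := by simp [lap_eq_fderiv, (hR z h).2.2]
      have := (norm_nonneg _).trans (hK z)
      rw [h0, norm_zero, zero_mul]
      positivity

theorem integrable_lap_mul_log_norm_sub (hφ : ContDiff ℝ (⊤ : ℕ∞) φ) (hc : HasCompactSupport φ)
    (a : ℂ) : Integrable (fun z => lap φ z * Real.log ‖z - a‖) := by
  have h := (integrable_lap_mul_log_norm (φ := fun z => φ (z + a)) (by fun_prop)
    (hc.comp_homeomorph (Homeomorph.addRight a))).comp_sub_right a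
  simpa [lap_comp_add_right] using h

theorem integral_lap_mul_sum_log_norm_sub (hφ : ContDiff ℝ (⊤ : ℕ∞) φ)
    (hc : HasCompactSupport φ) (s : Multiset ℂ) :
    Integrable (fun z => lap φ z * (s.map fun a => Real.log ‖z - a‖).sum) ∧
      ∫ z, lap φ z * (s.map fun a => Real.log ‖z - a‖).sum = 2 * Real.pi * (s.map φ).sum := by
  induction s using Multiset.induction with
  | empty => simp
  | cons a s ih =>
    have h := integrable_lap_mul_log_norm_sub hφ hc a
    simp only [Multiset.map_cons, Multiset.sum_cons, mul_add]
    refine ⟨h.add ih.1, ?_⟩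
    rw [integral_add h ih.1, ih.2, integral_lap_mul_log_norm_sub hφ hc]

theorem log_norm_eval_eq_sum_roots {f : Polynomial ℂ} {z : ℂ} (hz : f.eval z ≠ 0) :
    Real.log ‖f.eval z‖
      = Real.log ‖f.leadingCoeff‖ + (f.roots.map fun a => Real.log ‖z - a‖).sum := by
  have hf : f ≠ 0 := fun h => hz (by simp [h])
  have h := (IsAlgClosed.splits f).eval_eq_prod_roots z
  have hne : ∀ a ∈ f.roots, ‖z - a‖ ≠ 0 := fun a ha => by
    rw [norm_ne_zero_iff, sub_ne_zero]
    rintro rfl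
    exact hz (Polynomial.isRoot_of_mem_roots ha)
  have hprod : (f.roots.map fun a => z - a).prod ≠ 0 := fun h0 => hz (by rw [h, h0, mul_zero])
  rw [h, norm_mul, Real.log_mul (by simpa using hf) (by simpa using hprod)]
  congr 1
  clear h hprod hz
  revert hne
  induction f.roots using Multiset.induction with
  | empty => simp
  | cons a s ih =>
    intro hne
    have hs : ∀ a ∈ s, ‖z - a‖ ≠ 0 := fun b hb => hne b (Multiset.mem_cons_of_mem hb)
    have hp : ‖(s.map fun a => z - a).prod‖ ≠ 0 := by
      rw [norm_ne_zero_iff]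
      refine Multiset.prod_ne_zero fun h0 => ?_
      obtain ⟨b, hb, hb0⟩ := Multiset.mem_map.1 h0
      exact hs b hb (by simp [hb0])
    rw [Multiset.map_cons, Multiset.prod_cons, Multiset.map_cons, Multiset.sum_cons, norm_mul,
      Real.log_mul (hne a (Multiset.mem_cons_self a s)) hp, ih hs]

/-- The linear statistic of the roots of `f` is the pairing of `Δφ` with `(2π)⁻¹ log ‖f‖`. -/
theorem integral_lap_mul_log_norm_eval (hφ : ContDiff ℝ (⊤ : ℕ∞) φ) (hc : HasCompactSupport φ)
    {f : Polynomial ℂ} (hf : f ≠ 0) :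
    Integrable (fun z => lap φ z * Real.log ‖f.eval z‖) ∧
      ∫ z, lap φ z * Real.log ‖f.eval z‖ = 2 * Real.pi * (f.roots.map φ).sum := by
  have hae : (fun z => lap φ z * Real.log ‖f.leadingCoeff‖
      + lap φ z * (f.roots.map fun a => Real.log ‖z - a‖).sum)
      =ᵐ[volume] fun z => lap φ z * Real.log ‖f.eval z‖ := by
    have hfin : (f.rootSet ℂ).Finite := f.rootSet_finite ℂ
    filter_upwards [hfin.countable.ae_notMem volume] with z hz
    have hz' : f.eval z ≠ 0 := fun h => hz (by
      rw [Polynomial.mem_rootSet]; exact ⟨hf, by simpa using h⟩)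
    rw [log_norm_eval_eq_sum_roots hz', mul_add]
  have h1 := (integrable_lap hφ hc).mul_const (Real.log ‖f.leadingCoeff‖)
  have h2 := integral_lap_mul_sum_log_norm_sub hφ hc f.roots
  refine ⟨(h1.add h2.1).congr hae, ?_⟩
  rw [← integral_congr_ae hae, integral_add h1 h2.1, h2.2, integral_mul_const,
    integral_lap_eq_zero hφ hc, zero_mul, zero_add]

end Roots

section Gaussian

variable {V W : Type*} [NormedAddCommGroup V] [InnerProductSpace ℝ V] [FiniteDimensional ℝ V]
  [MeasurableSpace V] [BorelSpace V] [NormedAddCommGroup W] [InnerProductSpace ℝ W]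
  [FiniteDimensional ℝ W] [MeasurableSpace W] [BorelSpace W]

/-- The Gaussian probability measure with density proportional to `exp (-‖c‖²)`. -/
noncomputable def gaussianExpNormSq (V : Type*) [NormedAddCommGroup V] [InnerProductSpace ℝ V]
    [FiniteDimensional ℝ V] [MeasurableSpace V] [BorelSpace V] : Measure V :=
  volume.withDensity fun c =>
    ENNReal.ofReal ((Real.pi ^ (Module.finrank ℝ V / 2 : ℝ))⁻¹ * Real.exp (-‖c‖ ^ 2))

theorem gammaC_eq_gaussianExpNormSq (n : ℕ) :
    gammaC n = gaussianExpNormSq (EuclideanSpace ℂ (Fin n)) := by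
  have h : (Module.finrank ℝ (EuclideanSpace ℂ (Fin n)) / 2 : ℝ) = n := by
    rw [finrank_real_of_complex, finrank_euclideanSpace, Fintype.card_fin]
    push_cast
    ring
  simp only [gammaC, gaussianExpNormSq, h, Real.rpow_natCast]

theorem charFun_gaussianExpNormSq (t : V) :
    charFun (gaussianExpNormSq V) t = Complex.exp (-‖t‖ ^ 2 / 4) := by
  have h := GaussianFourier.integral_cexp_neg_mul_sq_norm_add (V := V) (b := 1) (by simp)
    Complex.I t
  rw [charFun_apply, gaussianExpNormSq, integral_withDensity_eq_integral_toReal_smul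
    (by fun_prop) (by simp)]
  have h2 : ∀ x : V, (ENNReal.ofReal ((Real.pi ^ (Module.finrank ℝ V / 2 : ℝ))⁻¹
      * Real.exp (-‖x‖ ^ 2))).toReal • Complex.exp (inner ℝ x t * Complex.I)
      = ((Real.pi ^ (Module.finrank ℝ V / 2 : ℝ) : ℝ) : ℂ)⁻¹
        * Complex.exp (-1 * ‖x‖ ^ 2 + Complex.I * inner ℝ t x) := fun x => by
    rw [ENNReal.toReal_ofReal (by positivity), real_inner_comm, Complex.exp_add,
      Complex.real_smul]
    push_cast
    ring_nf
  have h3 : (Real.pi : ℂ) ^ (Module.finrank ℝ V / 2 : ℂ)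
      = ((Real.pi ^ (Module.finrank ℝ V / 2 : ℝ) : ℝ) : ℂ) := by
    rw [Complex.ofReal_cpow Real.pi_pos.le]
    push_cast
    rfl
  have h4 : ((Real.pi ^ (Module.finrank ℝ V / 2 : ℝ) : ℝ) : ℂ) ≠ 0 :=
    Complex.ofReal_ne_zero.2 (Real.rpow_pos_of_pos Real.pi_pos _).ne'
  simp_rw [h2]
  rw [integral_const_mul, h, div_one, h3, ← mul_assoc, inv_mul_cancel₀ h4, one_mul, Complex.I_sq]
  ring_nf

instance : IsProbabilityMeasure (gaussianExpNormSq V) := by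
  have hint : Integrable (fun x : V => Real.exp (-1 * ‖x‖ ^ 2)) := by
    have h := (GaussianFourier.integrable_cexp_neg_mul_sq_norm_add (V := V) (b := 1) (by simp)
      0 0).norm
    refine h.congr (.of_forall fun x => ?_)
    have : (-1 * (‖x‖ : ℂ) ^ 2 + 0 * (inner ℝ 0 x : ℝ)) = ((-1 * ‖x‖ ^ 2 : ℝ) : ℂ) := by
      push_cast
      ring
    beta_reduce
    rw [this, Complex.norm_exp, Complex.ofReal_re]
  constructor
  have h := GaussianFourier.integral_rexp_neg_mul_sq_norm (V := V) (b := 1) (by simp)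
  rw [gaussianExpNormSq, withDensity_apply _ MeasurableSet.univ, Measure.restrict_univ,
    ← ofReal_integral_eq_lintegral_ofReal _ (.of_forall fun x => by positivity),
    integral_const_mul]
  · simp only [neg_mul, one_mul] at h
    rw [h, div_one, inv_mul_cancel₀ (Real.rpow_pos_of_pos Real.pi_pos _).ne', ENNReal.ofReal_one]
  · simpa using hint.const_mul _

theorem gaussianExpNormSq_absolutelyContinuous : gaussianExpNormSq V ≪ volume :=
  withDensity_absolutelyContinuous _ _

/-- A coisometric image of the Gaussian measure is the Gaussian measure of the target. -/
theorem map_gaussianExpNormSq {L : V → W} (hm : Measurable L)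
    (hL : ∀ t : W, ∃ w : V, ‖w‖ = ‖t‖ ∧ ∀ x, inner ℝ (L x) t = inner ℝ x w) :
    (gaussianExpNormSq V).map L = gaussianExpNormSq W := by
  have := Measure.isProbabilityMeasure_map (μ := gaussianExpNormSq V) hm.aemeasurable
  refine Measure.ext_of_charFun (funext fun t => ?_)
  obtain ⟨w, hw, hwx⟩ := hL t
  rw [charFun_apply, integral_map hm.aemeasurable (by fun_prop), charFun_gaussianExpNormSq]
  simp only [hwx]
  rw [← charFun_apply, charFun_gaussianExpNormSq, hw]

/-- Every unit-vector coordinate of a standard complex Gaussian vector is standard Gaussian. -/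
theorem map_inner_gammaC {n : ℕ} {u : EuclideanSpace ℂ (Fin n)} (hu : ‖u‖ = 1) :
    (gammaC n).map (fun c => inner ℂ u c) = gaussianExpNormSq ℂ := by
  rw [gammaC_eq_gaussianExpNormSq]
  refine map_gaussianExpNormSq (by fun_prop) fun t => ⟨t • u, by rw [norm_smul, hu, mul_one],
    fun x => ?_⟩
  simp only [Complex.inner, PiLp.inner_apply, map_sum, Finset.mul_sum, Complex.re_sum,
    PiLp.smul_apply, smul_eq_mul, RCLike.inner_apply, map_mul, Complex.conj_conj]
  exact Finset.sum_congr rfl fun i _ => by ring_nf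

end Gaussian

section LogMoment

theorem log_sq_le {y : ℝ} (hy : 0 < y) : Real.log y ^ 2 ≤ 4 * (y + y⁻¹) := by
  have hs : 0 < √y := Real.sqrt_pos.2 hy
  have h1 : Real.log y = 2 * Real.log √y := by
    rw [Real.log_sqrt hy.le]; ring
  have h2 := Real.log_le_self hs.le
  have h3 := Real.log_le_self (inv_pos.2 hs).le
  rw [Real.log_inv] at h3
  have h4 : Real.log √y ^ 2 ≤ √y ^ 2 + (√y)⁻¹ ^ 2 := by
    rcases le_total 0 (Real.log √y) with h | h <;>
      nlinarith [sq_nonneg √y, sq_nonneg (√y)⁻¹]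
  rw [inv_pow, Real.sq_sqrt hy.le] at h4
  rw [h1]
  linarith

theorem integrable_log_norm_sq_mul_exp :
    Integrable (fun z : ℂ => Real.log ‖z‖ ^ 2 * Real.exp (-‖z‖ ^ 2)) := by
  rw [integrable_fun_norm_addHaar volume (f := fun r => Real.log r ^ 2 * Real.exp (-r ^ 2))]
  have h0 := integrableOn_rpow_mul_exp_neg_mul_sq (b := 1) one_pos (s := 0) (by norm_num)
  have h2 := integrableOn_rpow_mul_exp_neg_mul_sq (b := 1) one_pos (s := 2) (by norm_num)
  refine ((h2.add h0).const_mul 4).mono' ?_ ((ae_restrict_iff' measurableSet_Ioi).2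
    (.of_forall fun r hr => ?_))
  · exact (by fun_prop : Measurable _).aestronglyMeasurable
  · have hr0 : 0 < r := hr
    have h := mul_le_mul_of_nonneg_left (log_sq_le hr0) hr0.le
    have h' : r * (4 * (r + r⁻¹)) = 4 * (r ^ 2 + 1) := by field_simp
    rw [h'] at h
    simp only [Complex.finrank_real_complex, smul_eq_mul, Pi.add_apply, Real.rpow_zero, neg_mul,
      one_mul, Real.rpow_two]
    rw [Real.norm_of_nonneg (by positivity)]
    calc r ^ (2 - 1) * (Real.log r ^ 2 * Real.exp (-r ^ 2))
        = (r * Real.log r ^ 2) * Real.exp (-r ^ 2) := by norm_num; ring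
      _ ≤ 4 * (r ^ 2 + 1) * Real.exp (-r ^ 2) := by gcongr
      _ = _ := by ring

/-- The second moment of `log |ζ|` for a standard complex Gaussian `ζ`. -/
noncomputable def logSecondMoment : ENNReal :=
  ∫⁻ z, ‖Real.log ‖z‖‖ₑ ^ 2 ∂(gaussianExpNormSq ℂ)

theorem logSecondMoment_ne_top : logSecondMoment ≠ ⊤ := by
  have h : logSecondMoment ≤ ∫⁻ z : ℂ, ‖Real.log ‖z‖ ^ 2 * Real.exp (-‖z‖ ^ 2)‖ₑ := by
    rw [logSecondMoment, gaussianExpNormSq, lintegral_withDensity_eq_lintegral_mul₀ (by fun_prop)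
      (by fun_prop)]
    refine lintegral_mono fun z => ?_
    rw [Pi.mul_apply, mul_comm, enorm_mul, enorm_pow]
    gcongr
    rw [Real.enorm_of_nonneg (by positivity)]
    refine ENNReal.ofReal_le_ofReal (mul_le_of_le_one_left (by positivity) ?_)
    refine inv_le_one_of_one_le₀ (Real.one_le_rpow ?_ (by positivity))
    linarith [Real.pi_gt_three]
  exact (h.trans_lt integrable_log_norm_sq_mul_exp.2).ne

theorem ae_inner_ne_zero {n : ℕ} {v : EuclideanSpace ℂ (Fin n)} (hv : v ≠ 0) :
    ∀ᵐ c ∂(gammaC n), (inner ℂ v c : ℂ) ≠ 0 := by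
  have hn : ‖v‖ ≠ 0 := norm_ne_zero_iff.2 hv
  have hu : ‖((‖v‖ : ℂ)⁻¹ • v)‖ = 1 := by
    rw [norm_smul]; simp [hn]
  have h : ∀ᵐ z ∂(gaussianExpNormSq ℂ), z ≠ 0 :=
    gaussianExpNormSq_absolutelyContinuous.ae_le (Measure.ae_ne volume 0)
  rw [← map_inner_gammaC hu] at h
  filter_upwards [ae_of_ae_map (by fun_prop) h] with c hc h0
  exact hc (by rw [inner_smul_left, h0, mul_zero])

theorem lintegral_log_inner_sub_log_norm_le {n : ℕ} (v : EuclideanSpace ℂ (Fin n)) :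
    ∫⁻ c, ‖Real.log ‖(inner ℂ v c : ℂ)‖ - Real.log ‖v‖‖ₑ ^ 2 ∂(gammaC n)
      ≤ logSecondMoment := by
  rcases eq_or_ne v 0 with rfl | hv
  · simp
  have hn : ‖v‖ ≠ 0 := norm_ne_zero_iff.2 hv
  have hu : ‖((‖v‖ : ℂ)⁻¹ • v)‖ = 1 := by
    rw [norm_smul]; simp [hn]
  rw [logSecondMoment, ← map_inner_gammaC hu, lintegral_map (by fun_prop) (by fun_prop)]
  refine (lintegral_congr_ae ?_).le
  filter_upwards [ae_inner_ne_zero hv] with c hc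
  rw [inner_smul_left, norm_mul, Real.log_mul (by simpa using hn) (by simpa using hc)]
  simp
  ring_nf

end LogMoment

section SecondMoment

theorem sq_lintegral_le {α : Type*} [MeasurableSpace α] (ν : Measure α) {g : α → ENNReal}
    (hg : AEMeasurable g ν) : (∫⁻ x, g x ∂ν) ^ 2 ≤ ν Set.univ * ∫⁻ x, g x ^ 2 ∂ν := by
  have h := ENNReal.lintegral_mul_le_Lp_mul_Lq ν Real.HolderConjugate.two_two
    (f := fun _ => 1) (g := g) aemeasurable_const hg
  have h2 : (∫⁻ x, g x ∂ν) ^ 2 ≤ _ := pow_le_pow_left' (by simpa using h) 2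
  refine h2.trans (le_of_eq ?_)
  rw [mul_pow, ← ENNReal.rpow_natCast, ← ENNReal.rpow_natCast, ← ENNReal.rpow_mul,
    ← ENNReal.rpow_mul]
  norm_num

/-- Pairing a random field of bounded second moment with an integrable weight. -/
theorem secondMoment_integral_mul_le {Ω α : Type*} [MeasurableSpace Ω] [MeasurableSpace α]
    {μ : Measure Ω} [IsProbabilityMeasure μ] {ρ : Measure α} [SFinite ρ] {f : α → ℝ}
    (hfm : Measurable f) (hf : Integrable f ρ) {L : Ω → α → ℝ}
    (hL : Measurable (Function.uncurry L)) {M : ENNReal} (hM : M ≠ ⊤)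
    (hLM : ∀ x, ∫⁻ c, ‖L c x‖ₑ ^ 2 ∂μ ≤ M) :
    (∀ᵐ c ∂μ, Integrable (fun x => f x * L c x) ρ) ∧
      MemLp (fun c => ∫ x, f x * L c x ∂ρ) 2 μ ∧
      ∫ c, (∫ x, f x * L c x ∂ρ) ^ 2 ∂μ ≤ M.toReal * (∫ x, |f x| ∂ρ) ^ 2 := by
  set ν : Measure α := ρ.withDensity fun x => ‖f x‖ₑ with hν
  set N : ENNReal := ∫⁻ x, ‖f x‖ₑ ∂ρ with hN
  have hN_top : N ≠ ⊤ := hf.2.ne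
  have hν_univ : ν Set.univ = N := by simp [hν, hN]
  have hLc (c : Ω) : Measurable (L c) := hL.comp measurable_prodMk_left
  have hν_int (c : Ω) : ∫⁻ x, ‖L c x‖ₑ ∂ν = ∫⁻ x, ‖f x * L c x‖ₑ ∂ρ := by
    rw [hν, lintegral_withDensity_eq_lintegral_mul _ hfm.enorm (hLc c).enorm]
    simp [enorm_mul]
  have hbound : ∫⁻ c, (∫⁻ x, ‖f x * L c x‖ₑ ∂ρ) ^ 2 ∂μ ≤ N * (M * N) := by
    calc ∫⁻ c, (∫⁻ x, ‖f x * L c x‖ₑ ∂ρ) ^ 2 ∂μ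
        ≤ ∫⁻ c, N * ∫⁻ x, ‖L c x‖ₑ ^ 2 ∂ν ∂μ := by
          refine lintegral_mono fun c => ?_
          rw [← hν_int, ← hν_univ]
          exact sq_lintegral_le ν (hLc c).enorm.aemeasurable
      _ = N * ∫⁻ c, ∫⁻ x, ‖L c x‖ₑ ^ 2 ∂ν ∂μ := lintegral_const_mul' _ _ hN_top
      _ = N * ∫⁻ x, ∫⁻ c, ‖L c x‖ₑ ^ 2 ∂μ ∂ν := by
          rw [lintegral_lintegral_swap (hL.enorm.pow_const 2).aemeasurable]
      _ ≤ N * ∫⁻ _, M ∂ν := by gcongr with x; exact hLM x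
      _ = N * (M * N) := by rw [lintegral_const, hν_univ]
  have htop : N * (M * N) ≠ ⊤ := ENNReal.mul_ne_top hN_top (ENNReal.mul_ne_top hM hN_top)
  have hjoint : Measurable (Function.uncurry fun c x => f x * L c x) :=
    (hfm.comp measurable_snd).mul hL
  have hT : StronglyMeasurable fun c => ∫ x, f x * L c x ∂ρ :=
    hjoint.stronglyMeasurable.integral_prod_right
  have hTsq : ∫⁻ c, ‖∫ x, f x * L c x ∂ρ‖ₑ ^ 2 ∂μ ≤ N * (M * N) :=
    (lintegral_mono fun c => by gcongr; exact enorm_integral_le_lintegral_enorm _).trans hbound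
  have hmem : MemLp (fun c => ∫ x, f x * L c x ∂ρ) 2 μ := by
    refine ⟨hT.aestronglyMeasurable, ?_⟩
    rw [eLpNorm_lt_top_iff_lintegral_rpow_enorm_lt_top two_ne_zero ENNReal.ofNat_ne_top]
    refine lt_of_le_of_lt ?_ htop.lt_top
    simpa using hTsq
  refine ⟨?_, hmem, ?_⟩
  · have hfin := ae_lt_top (hjoint.enorm.lintegral_prod_right'.pow_const 2)
      (ne_top_of_le_ne_top htop hbound)
    filter_upwards [hfin] with c hc
    refine ⟨(hfm.mul (hLc c)).aestronglyMeasurable, ?_⟩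
    by_contra h
    rw [hasFiniteIntegral_iff_enorm, not_lt, top_le_iff] at h
    change (∫⁻ y, ‖f y * L c y‖ₑ ∂ρ) ^ 2 < ⊤ at hc
    rw [h] at hc
    simp at hc
  · have hNf : N.toReal = ∫ x, |f x| ∂ρ := (integral_norm_eq_lintegral_enorm hf.1).symm
    rw [integral_eq_lintegral_of_nonneg_ae (.of_forall fun c => sq_nonneg _)
      (hT.aestronglyMeasurable.pow 2), ← hNf]
    calc (∫⁻ c, ENNReal.ofReal ((∫ x, f x * L c x ∂ρ) ^ 2) ∂μ).toReal
        ≤ (N * (M * N)).toReal := by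
          refine ENNReal.toReal_mono htop (le_trans (le_of_eq ?_) hTsq)
          refine lintegral_congr fun c => ?_
          rw [← Real.enorm_of_nonneg (sq_nonneg _), enorm_pow]
      _ = M.toReal * N.toReal ^ 2 := by
          rw [ENNReal.toReal_mul, ENNReal.toReal_mul]; ring

end SecondMoment

section Main

variable {n : ℕ}

instance : IsProbabilityMeasure (gammaC n) := by
  rw [gammaC_eq_gaussianExpNormSq]; infer_instance

/-- The vector `v(z)` with `f_c(z) = ⟪v(z), c⟫`. -/
noncomputable def evalVec (p : Fin n → Polynomial ℂ) (z : ℂ) : EuclideanSpace ℂ (Fin n) :=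
  WithLp.toLp 2 fun j => starRingEnd ℂ ((p j).eval z)

theorem eval_sum_smul_eq_inner (p : Fin n → Polynomial ℂ) (c : EuclideanSpace ℂ (Fin n))
    (z : ℂ) : (∑ j, c j • p j).eval z = inner ℂ (evalVec p z) c := by
  simp [evalVec, PiLp.inner_apply, Polynomial.eval_finsetSum]

theorem continuous_evalVec (p : Fin n → Polynomial ℂ) : Continuous (evalVec p) := by
  unfold evalVec
  fun_prop

theorem ae_sum_smul_ne_zero {p : Fin n → Polynomial ℂ} (hp : ∃ j, p j ≠ 0) :
    ∀ᵐ c ∂(gammaC n), ∑ j, c j • p j ≠ 0 := by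
  obtain ⟨j, hj⟩ := hp
  obtain ⟨z, hz⟩ : ∃ z, (p j).eval z ≠ 0 := by
    by_contra! h
    exact hj (Polynomial.funext (by simpa using h))
  have hv : evalVec p z ≠ 0 := fun h => hz (by
    simpa [evalVec] using congrArg (fun v : EuclideanSpace ℂ (Fin n) => v j) h)
  filter_upwards [ae_inner_ne_zero hv] with c hc h0
  rw [← eval_sum_smul_eq_inner, h0, Polynomial.eval_zero] at hc
  exact hc rfl

theorem measurable_log_inner_sub (p : Fin n → Polynomial ℂ) :
    Measurable (Function.uncurry fun (c : EuclideanSpace ℂ (Fin n)) (z : ℂ) =>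
      Real.log ‖(inner ℂ (evalVec p z) c : ℂ)‖ - Real.log ‖evalVec p z‖) := by
  have h := continuous_evalVec p
  have h1 : Continuous fun q : EuclideanSpace ℂ (Fin n) × ℂ =>
      ‖(inner ℂ (evalVec p q.2) q.1 : ℂ)‖ := by fun_prop
  have h2 : Continuous fun q : EuclideanSpace ℂ (Fin n) × ℂ => ‖evalVec p q.2‖ := by fun_prop
  exact (Real.measurable_log.comp h1.measurable).sub (Real.measurable_log.comp h2.measurable)

theorem variance_sum_roots_le {p : Fin n → Polynomial ℂ} (hp : ∃ j, p j ≠ 0) {φ : ℂ → ℝ}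
    (hφ : ContDiff ℝ (⊤ : ℕ∞) φ) (hc : HasCompactSupport φ) :
    (∫ c, (((∑ j, c j • p j).roots.map φ).sum) ^ 2 ∂(gammaC n))
        - (∫ c, (((∑ j, c j • p j).roots.map φ).sum) ∂(gammaC n)) ^ 2
      ≤ ((2 * Real.pi)⁻¹ ^ 2 * logSecondMoment.toReal) * (∫ z : ℂ, |lap φ z|) ^ 2 := by
  set L : EuclideanSpace ℂ (Fin n) → ℂ → ℝ := fun c z =>
    Real.log ‖(inner ℂ (evalVec p z) c : ℂ)‖ - Real.log ‖evalVec p z‖ with hL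
  set T : EuclideanSpace ℂ (Fin n) → ℝ := fun c => ∫ z, lap φ z * L c z with hT
  set D : ℝ := ∫ z, lap φ z * Real.log ‖evalVec p z‖ with hD
  obtain ⟨hint, hmem, hle⟩ := secondMoment_integral_mul_le (μ := gammaC n)
    (continuous_lap hφ).measurable (integrable_lap hφ hc) (measurable_log_inner_sub p)
    logSecondMoment_ne_top fun z => lintegral_log_inner_sub_log_norm_le (evalVec p z)
  have hX : (fun c : EuclideanSpace ℂ (Fin n) => ((∑ j, c j • p j).roots.map φ).sum)
      =ᵐ[gammaC n] fun c => (2 * Real.pi)⁻¹ * (T c + D) := by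
    filter_upwards [hint, ae_sum_smul_ne_zero hp] with c hci hc0
    obtain ⟨h1, h2⟩ := integral_lap_mul_log_norm_eval hφ hc hc0
    simp only [eval_sum_smul_eq_inner] at h1 h2
    have h3 : Integrable fun z => lap φ z * Real.log ‖evalVec p z‖ := by
      refine (h1.sub hci).congr (.of_forall fun z => ?_)
      simp only [Pi.sub_apply]
      ring
    have h4 : T c + D = 2 * Real.pi * ((∑ j, c j • p j).roots.map φ).sum := by
      rw [← h2, hT, hD, ← integral_add hci h3]
      refine integral_congr_ae (.of_forall fun z => ?_)
      simp only
      ring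
    rw [h4, inv_mul_cancel_left₀ (by positivity)]
  have hTm : AEStronglyMeasurable T (gammaC n) := hmem.1
  have hYmem : MemLp (fun c => (2 * Real.pi)⁻¹ * (T c + D)) 2 (gammaC n) :=
    (hmem.add (memLp_const D)).const_mul _
  have hXvar := ProbabilityTheory.variance_eq_sub (hYmem.ae_eq hX.symm)
  simp only [Pi.pow_apply] at hXvar
  rw [← hXvar, ProbabilityTheory.variance_congr hX, ProbabilityTheory.variance_const_mul,
    ProbabilityTheory.variance_add_const hTm, mul_assoc]
  gcongr
  exact (ProbabilityTheory.variance_le_expectation_sq hTm).trans hle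

end Main

/-- Universal variance bound for linear statistics of zeros of the Gaussian random
polynomial `f_c = ∑ⱼ cⱼ pⱼ`: there is a constant `C > 0`, independent of `n`, of the
polynomials `pⱼ` (not all zero), and of `φ`, such that
`Var(∑_{a ∈ Z(f_c)} φ(a)) ≤ C (∫_ℂ |Δφ| dλ)²`. -/
theorem variance_bound_universal :
    ∃ C : ℝ, 0 < C ∧ ∀ n : ℕ, 1 ≤ n → ∀ p : Fin n → Polynomial ℂ, (∃ j, p j ≠ 0) →
      ∀ φ : ℂ → ℝ, ContDiff ℝ (⊤ : ℕ∞) φ → HasCompactSupport φ →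
      (∫ c : EuclideanSpace ℂ (Fin n),
            (((∑ j, c j • p j).roots.map φ).sum) ^ 2 ∂(gammaC n))
          - (∫ c : EuclideanSpace ℂ (Fin n),
              (((∑ j, c j • p j).roots.map φ).sum) ∂(gammaC n)) ^ 2
        ≤ C * (∫ z : ℂ, |lap φ z|) ^ 2 := by
  refine ⟨(2 * Real.pi)⁻¹ ^ 2 * logSecondMoment.toReal + 1, by positivity,
    fun n _ p hp φ hφ hc => (variance_sum_roots_le hp hφ hc).trans ?_⟩
  gcongr
  linarith
end

section
/- (One-variable case of Corollary 1.3: almost sure convergence of normalized zero measures.) Let U ⊆ ℂ be open. For each N ≥ 1 let n_N ≥ 1 and let p_{N,1}, …, p_{N,n_N} ∈ ℂ[z] be polynomials of degree at most N having no common zero in U. Let P = ⊗_{N=1}^∞ γ_{n_N} be the product probability measure on Ω = ∏_{N=1}^∞ ℂ^{n_N}, and for ω = (c^{(N)})_N ∈ Ω set f_N^ω = ∑_{j=1}^{n_N} c_j^{(N)} p_{N,j}. Suppose there is a measure ψ on U, finite on compact subsets of U, such that for every smooth compactly supported function φ : ℂ → ℝ with support contained in U, (1/N) ∫_{ℂ^{n_N}}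 ( ∑_{a ∈ Z(f_{N,c})} φ(a) ) dγ_{n_N}(c) → ∫_U φ dψ as N → ∞. Then for P-almost every ω ∈ Ω, for every continuous compactly supported function φ : ℂ → ℝ with support contained in U, (1/N) ∑_{a ∈ Z(f_N^ω)} φ(a) → ∫_U φ dψ as N → ∞. -/
open MeasureTheory

open Filter Topology

lemma charFun_withDensity_gaussian {V : Type*} [NormedAddCommGroup V] [InnerProductSpace ℝ V]
    [FiniteDimensional ℝ V] [MeasurableSpace V] [BorelSpace V] (n : ℕ)
    (hn : Module.finrank ℝ V = 2 * n) (t : V) :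
    charFun ((volume : Measure V).withDensity
      fun c => ENNReal.ofReal ((Real.pi ^ n)⁻¹ * Real.exp (-‖c‖ ^ 2))) t =
      Complex.exp (-(‖t‖ ^ 2 / 4 : ℝ)) := by
  rw [charFun_apply, integral_withDensity_eq_integral_toReal_smul (by fun_prop)
    (by filter_upwards with x using ENNReal.ofReal_lt_top)]
  have h := GaussianFourier.integral_cexp_neg_mul_sq_norm_add (b := 1) (V := V) (by simp)
    Complex.I t
  have hpi : (Real.pi : ℂ) ^ n ≠ 0 := pow_ne_zero _ (by exact_mod_cast Real.pi_ne_zero)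
  have h2 : ((Real.pi : ℂ) / 1) ^ ((Module.finrank ℝ V : ℂ) / 2) = (Real.pi : ℂ) ^ n := by
    rw [hn, div_one, ← Complex.cpow_natCast]
    congr 1
    push_cast
    field_simp
  rw [h2] at h
  have h3 : ∀ a : V, (ENNReal.ofReal ((Real.pi ^ n)⁻¹ * Real.exp (-‖a‖ ^ 2))).toReal •
      Complex.exp ((inner ℝ a t : ℝ) * Complex.I) =
      ((Real.pi : ℂ) ^ n)⁻¹ * Complex.exp (-1 * (‖a‖ : ℂ) ^ 2 + Complex.I * (inner ℝ t a : ℝ)) := by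
    intro a
    rw [ENNReal.toReal_ofReal (by positivity), Complex.real_smul, Complex.exp_add,
      real_inner_comm]
    push_cast
    ring_nf
  simp_rw [h3]
  rw [integral_const_mul, h, ← mul_assoc, inv_mul_cancel₀ hpi, one_mul]
  congr 1
  push_cast
  rw [Complex.I_sq]
  ring

/-- The law of `∑ j, c j * v j` under the standard complex Gaussian measure on `ℂⁿ`, for any unit
vector `v`. -/
noncomputable def gaussC : Measure ℂ :=
  volume.withDensity fun c => ENNReal.ofReal ((Real.pi ^ 1)⁻¹ * Real.exp (-‖c‖ ^ 2))

lemma integrable_norm_rpow_mul_exp (q : ℝ) (hq : -2 < q) :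
    Integrable (fun z : ℂ => ‖z‖ ^ q * Real.exp (-‖z‖ ^ (2 : ℝ))) := by
  by_contra h
  have h1 := Complex.integral_rpow_mul_exp_neg_rpow (p := 2) (q := q) (by norm_num) hq
  rw [integral_undef h] at h1
  have : 0 < 2 * Real.pi / 2 * Real.Gamma ((q + 2) / 2) :=
    mul_pos (by positivity) (Real.Gamma_pos_of_pos (by linarith))
  linarith

lemma Real.log_sq_le_add_inv {r : ℝ} (hr : 0 ≤ r) : Real.log r ^ 2 ≤ 4 * (r + r⁻¹) := by
  have key : ∀ s : ℝ, 1 ≤ s → Real.log s ^ 2 ≤ 4 * s := by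
    intro s hs
    have h1 : Real.log s = 2 * Real.log (√s) := by rw [Real.log_sqrt (by linarith)]; ring
    have h2 := Real.log_le_sub_one_of_pos (Real.sqrt_pos.2 (by linarith : 0 < s))
    have h3 : 0 ≤ Real.log (√s) := Real.log_nonneg (Real.one_le_sqrt.2 hs)
    have h4 := Real.sq_sqrt (by linarith : 0 ≤ s)
    rw [h1]
    nlinarith [Real.sqrt_nonneg s]
  rcases le_total 1 r with h | h
  · have := key r h
    have := inv_nonneg.2 hr
    linarith
  · rcases hr.eq_or_lt with rfl | hr
    · simp
    · have := key r⁻¹ ((one_le_inv₀ hr).2 h)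
      rw [Real.log_inv, neg_sq] at this
      linarith

lemma integrable_one_add_log_sq_mul_exp :
    Integrable (fun z : ℂ => (1 + Real.log ‖z‖ ^ 2) * Real.exp (-‖z‖ ^ 2)) := by
  have h0 := integrable_norm_rpow_mul_exp 0 (by norm_num)
  have h1 := (integrable_norm_rpow_mul_exp 1 (by norm_num)).const_mul 4
  have h2 := (integrable_norm_rpow_mul_exp (-1) (by norm_num)).const_mul 4
  refine ((h0.add h1).add h2).mono' (Measurable.aestronglyMeasurable (by fun_prop)) ?_
  filter_upwards with z
  rw [Real.norm_of_nonneg (by positivity)]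
  have := Real.log_sq_le_add_inv (norm_nonneg z)
  simp only [Pi.add_apply, Real.rpow_zero, Real.rpow_one, Real.rpow_neg_one, Real.rpow_two]
  nlinarith [Real.exp_pos (-‖z‖ ^ 2)]

lemma lintegral_log_sq_gaussC_lt_top :
    ∫⁻ z, ENNReal.ofReal (Real.log ‖z‖ ^ 2) ∂gaussC < ⊤ := by
  rw [gaussC, lintegral_withDensity_eq_lintegral_mul _ (by fun_prop) (by fun_prop)]
  refine lt_of_le_of_lt (lintegral_mono fun z => ?_)
    (integrable_one_add_log_sq_mul_exp.const_mul (Real.pi ^ 1)⁻¹).lintegral_lt_top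
  simp only [Pi.mul_apply]
  rw [← ENNReal.ofReal_mul (by positivity)]
  refine ENNReal.ofReal_le_ofReal ?_
  rw [mul_assoc]
  have := Real.exp_pos (-‖z‖ ^ 2)
  refine mul_le_mul_of_nonneg_left ?_ (by positivity)
  nlinarith

instance : IsFiniteMeasure gaussC := by
  refine ⟨?_⟩
  rw [gaussC, withDensity_apply _ MeasurableSet.univ, setLIntegral_univ]
  refine lt_of_le_of_lt (lintegral_mono fun z => ENNReal.ofReal_le_ofReal ?_)
    (integrable_one_add_log_sq_mul_exp.const_mul (Real.pi ^ 1)⁻¹).lintegral_lt_top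
  refine mul_le_mul_of_nonneg_left ?_ (by positivity)
  have := Real.exp_pos (-‖z‖ ^ 2)
  nlinarith [mul_nonneg (sq_nonneg (Real.log ‖z‖)) this.le]

lemma map_gammaC_eq_gaussC {n : ℕ} [IsFiniteMeasure (gammaC n)] (v : Fin n → ℂ)
    (hv : ∑ j, ‖v j‖ ^ 2 = 1) :
    (gammaC n).map (fun c => ∑ j, c j * v j) = gaussC := by
  have hm : Measurable fun c : EuclideanSpace ℂ (Fin n) => ∑ j, c j * v j :=
    Continuous.measurable (by fun_prop)
  refine Measure.ext_of_charFun (funext fun t => ?_)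
  rw [gaussC, charFun_withDensity_gaussian 1 (by simp), charFun_apply,
    integral_map hm.aemeasurable (Continuous.aestronglyMeasurable (by fun_prop))]
  have hf : Module.finrank ℝ (EuclideanSpace ℂ (Fin n)) = 2 * n := by
    rw [← Module.finrank_mul_finrank ℝ ℂ]
    simp
  have h := charFun_withDensity_gaussian n hf
    (WithLp.toLp 2 fun j => (starRingEnd ℂ) (v j) * t)
  rw [charFun_apply] at h
  rw [gammaC]
  have hin : ∀ c : EuclideanSpace ℂ (Fin n), inner ℝ (∑ j, c j * v j) t =
      inner ℝ c (WithLp.toLp 2 fun j => (starRingEnd ℂ) (v j) * t) := by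
    intro c
    simp only [PiLp.inner_apply, Complex.inner, map_sum, map_mul, Finset.mul_sum, Complex.re_sum]
    refine Finset.sum_congr rfl fun j _ => ?_
    congr 1
    ring
  have hnorm : ‖WithLp.toLp 2 fun j => (starRingEnd ℂ) (v j) * t‖ ^ 2 = ‖t‖ ^ 2 := by
    simp only [EuclideanSpace.norm_sq_eq, norm_mul, mul_pow, RCLike.norm_conj]
    rw [← Finset.sum_mul, hv, one_mul]
  rw [hnorm] at h
  simp_rw [hin]
  exact h

lemma sum_sq_div_sqrt_eq_one {n : ℕ} {v : Fin n → ℂ} (hv : ∃ j, v j ≠ 0) :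
    0 < √(∑ j, ‖v j‖ ^ 2) ∧ ∑ j, ‖v j / (√(∑ j, ‖v j‖ ^ 2) : ℝ)‖ ^ 2 = 1 := by
  obtain ⟨j, hj⟩ := hv
  have hpos : 0 < ∑ j, ‖v j‖ ^ 2 :=
    Finset.sum_pos' (fun i _ => by positivity) ⟨j, Finset.mem_univ j, by positivity⟩
  refine ⟨Real.sqrt_pos.2 hpos, ?_⟩
  simp only [norm_div, div_pow, Complex.norm_real, Real.norm_eq_abs, sq_abs]
  rw [← Finset.sum_div, Real.sq_sqrt hpos.le, div_self hpos.ne']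

lemma ae_ne_zero_gammaC {n : ℕ} [IsFiniteMeasure (gammaC n)] {v : Fin n → ℂ}
    (hv : ∃ j, v j ≠ 0) : ∀ᵐ c ∂(gammaC n), ∑ j, c j * v j ≠ 0 := by
  obtain ⟨hs, h1⟩ := sum_sq_div_sqrt_eq_one hv
  have hmap := map_gammaC_eq_gaussC _ h1
  have h0 : ∀ᵐ z ∂gaussC, z ≠ 0 := by
    refine (withDensity_absolutelyContinuous _ _).ae_le ?_
    exact Measure.ae_ne volume 0
  rw [← hmap] at h0
  have := ae_of_ae_map (Continuous.aemeasurable (by fun_prop)) h0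
  filter_upwards [this] with c hc h
  refine hc ?_
  simp_rw [← mul_div_assoc]
  rw [← Finset.sum_div, h, zero_div]

lemma lintegral_log_sq_gammaC {n : ℕ} [IsFiniteMeasure (gammaC n)] {v : Fin n → ℂ}
    (hv : ∃ j, v j ≠ 0) :
    ∫⁻ c, ENNReal.ofReal ((Real.log ‖∑ j, c j * v j‖ -
      Real.log (√(∑ j, ‖v j‖ ^ 2))) ^ 2) ∂(gammaC n) =
      ∫⁻ z, ENNReal.ofReal (Real.log ‖z‖ ^ 2) ∂gaussC := by
  obtain ⟨hs, h1⟩ := sum_sq_div_sqrt_eq_one hv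
  rw [← map_gammaC_eq_gaussC _ h1, lintegral_map (by fun_prop)
    (Continuous.measurable (by fun_prop))]
  refine lintegral_congr_ae ?_
  filter_upwards [ae_ne_zero_gammaC hv] with c hc
  simp_rw [← mul_div_assoc]
  rw [← Finset.sum_div, norm_div, Complex.norm_real, Real.norm_of_nonneg hs.le,
    Real.log_div (norm_ne_zero_iff.2 hc) hs.ne']

lemma integrable_log_norm_sub_mul {G : ℂ → ℝ} (hG : Continuous G) (hGs : HasCompactSupport G)
    (a : ℂ) : Integrable fun z => Real.log ‖z - a‖ * G z := by
  have hcont : Continuous fun z => G z * Real.exp (‖z - a‖ ^ 2) := by fun_prop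
  obtain ⟨C, hC⟩ := hcont.bounded_above_of_compact_support hGs.mul_right
  refine ((integrable_one_add_log_sq_mul_exp.comp_sub_right a).const_mul C).mono'
    (Measurable.aestronglyMeasurable (by fun_prop)) ?_
  filter_upwards with z
  have h1 := hC z
  rw [norm_mul, Real.norm_of_nonneg (Real.exp_pos _).le] at h1
  have hG' : ‖G z‖ ≤ C * Real.exp (-‖z - a‖ ^ 2) := by
    calc ‖G z‖ = ‖G z‖ * Real.exp (‖z - a‖ ^ 2) * Real.exp (-‖z - a‖ ^ 2) := by
          rw [mul_assoc, ← Real.exp_add]; simp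
      _ ≤ _ := by gcongr
  have hlog : ‖Real.log ‖z - a‖‖ ≤ 1 + Real.log ‖z - a‖ ^ 2 := by
    rw [Real.norm_eq_abs, abs_le]
    constructor <;> nlinarith [sq_nonneg (Real.log ‖z - a‖ - 1), sq_nonneg (Real.log ‖z - a‖ + 1)]
  rw [norm_mul]
  calc _ ≤ (1 + Real.log ‖z - a‖ ^ 2) * (C * Real.exp (-‖z - a‖ ^ 2)) := by gcongr
    _ = _ := by ring

/-- `F` is the logarithmic potential of the density `G`, a continuous function of compact support
and vanishing integral. -/
structure IsLogPotential (F G : ℂ → ℝ) : Prop where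
  continuous : Continuous G
  hasCompactSupport : HasCompactSupport G
  integral_eq_zero : ∫ z, G z = 0
  eq_integral : ∀ a, F a = ∫ z, Real.log ‖z - a‖ * G z

namespace IsLogPotential

variable {F G : ℂ → ℝ}

lemma sum_map_multiset (h : IsLogPotential F G) (s : Multiset ℂ) :
    Integrable (fun z => Real.log ‖(s.map (z - ·)).prod‖ * G z) ∧
      (s.map F).sum = ∫ z, Real.log ‖(s.map (z - ·)).prod‖ * G z := by
  induction s using Multiset.induction with
  | empty => simp
  | cons a s ih =>
    have hae : (fun z => Real.log ‖z - a‖ * G z + Real.log ‖(s.map (z - ·)).prod‖ * G z) =ᵐ[volume]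
        fun z => Real.log ‖((a ::ₘ s).map (z - ·)).prod‖ * G z := by
      have hfin : ∀ᵐ z : ℂ, z ∉ ((a ::ₘ s).toFinset : Set ℂ) :=
        measure_eq_zero_iff_ae_notMem.1 (Finset.measure_zero _ _)
      filter_upwards [hfin] with z hz
      have hz' : ∀ b ∈ a ::ₘ s, z - b ≠ 0 := by
        intro b hb h0
        exact hz (by simpa [sub_eq_zero.1 h0] using hb)
      have h1 : (s.map (z - ·)).prod ≠ 0 := by
        refine Multiset.prod_ne_zero fun h0 => ?_
        obtain ⟨b, hb, hb0⟩ := Multiset.mem_map.1 h0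
        exact hz' b (Multiset.mem_cons_of_mem hb) hb0
      rw [Multiset.map_cons, Multiset.prod_cons, norm_mul, Real.log_mul
        (norm_ne_zero_iff.2 (hz' a (Multiset.mem_cons_self a s))) (norm_ne_zero_iff.2 h1)]
      ring
    have hi := integrable_log_norm_sub_mul h.continuous h.hasCompactSupport a
    refine ⟨(hi.add ih.1).congr hae, ?_⟩
    rw [← integral_congr_ae hae, integral_add hi ih.1, Multiset.map_cons, Multiset.sum_cons, ih.2,
      h.eq_integral]

lemma sum_map_roots (h : IsLogPotential F G) (f : Polynomial ℂ) :
    Integrable (fun z => Real.log ‖f.eval z‖ * G z) ∧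
      (f.roots.map F).sum = ∫ z, Real.log ‖f.eval z‖ * G z := by
  by_cases hf : f = 0
  · simp [hf]
  have hev : ∀ z, f.eval z = f.leadingCoeff * (f.roots.map (z - ·)).prod := by
    intro z
    conv_lhs => rw [(IsAlgClosed.splits f).eq_prod_roots]
    simp [Polynomial.eval_multiset_prod]
  have hl : f.leadingCoeff ≠ 0 := by simpa using hf
  obtain ⟨hi, hs⟩ := h.sum_map_multiset f.roots
  have hGi : Integrable G := h.continuous.integrable_of_hasCompactSupport h.hasCompactSupport
  have hae : (fun z => Real.log ‖f.leadingCoeff‖ * G z +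
      Real.log ‖(f.roots.map (z - ·)).prod‖ * G z) =ᵐ[volume]
      fun z => Real.log ‖f.eval z‖ * G z := by
    have hfin : ∀ᵐ z : ℂ, z ∉ (f.roots.toFinset : Set ℂ) :=
      measure_eq_zero_iff_ae_notMem.1 (Finset.measure_zero _ _)
    filter_upwards [hfin] with z hz
    have h1 : f.eval z ≠ 0 := by
      intro h0
      exact hz (by simpa [hf] using h0)
    rw [hev] at h1 ⊢
    rw [norm_mul, Real.log_mul (norm_ne_zero_iff.2 hl)
      (norm_ne_zero_iff.2 (right_ne_zero_of_mul h1))]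
    ring
  refine ⟨((hGi.const_mul _).add hi).congr hae, ?_⟩
  rw [← integral_congr_ae hae, integral_add (hGi.const_mul _) hi, integral_const_mul,
    h.integral_eq_zero, mul_zero, zero_add, hs]

end IsLogPotential

lemma integrable_log_mul_of_continuousOn {q G : ℂ → ℝ} (hG : Continuous G)
    (hGs : HasCompactSupport G) (hq : ContinuousOn q (tsupport G)) :
    Integrable fun z => q z * G z := by
  rw [← integrableOn_iff_integrable_of_support_subset (s := tsupport G)]
  · exact (hq.mul hG.continuousOn).integrableOn_compact hGs
  · exact (Function.support_mul_subset_right _ _).trans (subset_tsupport G)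

/-- Linear statistics of the zeros of a Gaussian random polynomial deviate from a constant by a
quantity controlled by a nonnegative random variable of bounded expectation. -/
lemma IsLogPotential.exists_deviation_bound {F G : ℂ → ℝ} (h : IsLogPotential F G) {n : ℕ}
    [IsFiniteMeasure (gammaC n)] {p : Fin n → Polynomial ℂ}
    (hbase : ∀ z ∈ tsupport G, ∃ j, (p j).eval z ≠ 0) :
    ∃ (κ : ℝ) (V : EuclideanSpace ℂ (Fin n) → ENNReal), Measurable V ∧
      ∫⁻ c, V c ∂(gammaC n) ≤ (∫⁻ z, ENNReal.ofReal (Real.log ‖z‖ ^ 2) ∂gaussC) * ∫⁻ z, ‖G z‖ₑ ∧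
      StronglyMeasurable (fun c : EuclideanSpace ℂ (Fin n) =>
        ((∑ j, c j • p j).roots.map F).sum) ∧
      ∀ (c : EuclideanSpace ℂ (Fin n)) (l : ℝ), 0 < l →
        ‖((∑ j, c j • p j).roots.map F).sum - κ‖ₑ ≤
          ENNReal.ofReal l * (∫⁻ z, ‖G z‖ₑ) + ENNReal.ofReal l⁻¹ * V c := by
  have hev : ∀ (c : EuclideanSpace ℂ (Fin n)) z,
      (∑ j, c j • p j).eval z = ∑ j, c j * (p j).eval z := by
    intro c z
    simp [Polynomial.eval_finsetSum]
  set q : ℂ → ℝ := fun z => Real.log (√(∑ j, ‖(p j).eval z‖ ^ 2)) with hqdef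
  set Y : EuclideanSpace ℂ (Fin n) → ℂ → ℝ :=
    fun c z => Real.log ‖∑ j, c j * (p j).eval z‖ - q z with hY
  have hcont : Continuous fun x : EuclideanSpace ℂ (Fin n) × ℂ =>
      ∑ j, x.1 j * (p j).eval x.2 := by
    refine continuous_finsetSum _ fun j _ => ?_
    have := (p j).continuous
    fun_prop
  have hqm : Measurable q := by
    have : ∀ j, Measurable fun z => (p j).eval z := fun j => (p j).continuous.measurable
    fun_prop
  have hLm : Measurable fun x : EuclideanSpace ℂ (Fin n) × ℂ =>
      Real.log ‖∑ j, x.1 j * (p j).eval x.2‖ :=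
    Real.measurable_log.comp hcont.norm.measurable
  have hYm : Measurable fun x : EuclideanSpace ℂ (Fin n) × ℂ => Y x.1 x.2 :=
    hLm.sub (hqm.comp measurable_snd)
  have hGm := h.continuous.measurable
  have hqi : Integrable fun z => q z * G z := by
    refine integrable_log_mul_of_continuousOn h.continuous h.hasCompactSupport ?_
    refine ContinuousOn.log (Continuous.continuousOn ?_) fun z hz => ?_
    · have : ∀ j, Continuous fun z => (p j).eval z := fun j => (p j).continuous
      fun_prop
    · exact (sum_sq_div_sqrt_eq_one (hbase z hz)).1.ne'
  have hVm : Measurable fun x : EuclideanSpace ℂ (Fin n) × ℂ =>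
      ENNReal.ofReal (Y x.1 x.2 ^ 2) * ‖G x.2‖ₑ := by fun_prop
  refine ⟨∫ z, q z * G z, fun c => ∫⁻ z, ENNReal.ofReal (Y c z ^ 2) * ‖G z‖ₑ,
    hVm.lintegral_prod_right', ?_, ?_, ?_⟩
  · rw [lintegral_lintegral_swap hVm.aemeasurable, ← lintegral_const_mul' _ _
      lintegral_log_sq_gaussC_lt_top.ne]
    refine lintegral_mono fun z => ?_
    rw [lintegral_mul_const _ (by fun_prop)]
    by_cases hz : z ∈ tsupport G
    · rw [lintegral_log_sq_gammaC (hbase z hz)]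
    · simp [image_eq_zero_of_notMem_tsupport hz]
  · have : (fun c : EuclideanSpace ℂ (Fin n) => ((∑ j, c j • p j).roots.map F).sum) =
        fun c => ∫ z, Real.log ‖∑ j, c j * (p j).eval z‖ * G z := by
      funext c
      rw [(h.sum_map_roots _).2]
      simp_rw [hev]
    rw [this]
    exact StronglyMeasurable.integral_prod_right'
      (f := fun x : EuclideanSpace ℂ (Fin n) × ℂ =>
        Real.log ‖∑ j, x.1 j * (p j).eval x.2‖ * G x.2)
      (hLm.mul (hGm.comp measurable_snd)).stronglyMeasurable
  · intro c l hl
    obtain ⟨hi, hs⟩ := h.sum_map_roots (∑ j, c j • p j)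
    rw [hs, ← integral_sub hi hqi]
    refine (enorm_integral_le_lintegral_enorm _).trans ?_
    rw [← lintegral_const_mul' _ _ ENNReal.ofReal_ne_top,
      ← lintegral_const_mul' _ _ ENNReal.ofReal_ne_top,
      ← lintegral_add_left (by fun_prop)]
    refine lintegral_mono fun z => ?_
    simp only
    rw [← sub_mul, enorm_mul, hev, ← mul_assoc, ← add_mul, ← ENNReal.ofReal_mul (by positivity),
      ← ENNReal.ofReal_add (by positivity) (by positivity), Real.enorm_eq_ofReal_abs]
    gcongr
    change |Y c z| ≤ _
    have h1 : 0 ≤ (l - |Y c z|) ^ 2 + l * |Y c z| := by positivity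
    have h2 : l + l⁻¹ * Y c z ^ 2 - |Y c z| = l⁻¹ * ((l - |Y c z|) ^ 2 + l * |Y c z|) := by
      rw [← sq_abs (Y c z)]
      field_simp
      ring
    have h3 := mul_nonneg (inv_pos.2 hl).le h1
    linarith

lemma IsLogPotential.ae_tendsto {F G : ℂ → ℝ} (h : IsLogPotential F G) {nN : ℕ → ℕ}
    {p : (N : ℕ) → Fin (nN N) → Polynomial ℂ}
    (hbase : ∀ N, ∀ z ∈ tsupport G, ∃ j, (p N j).eval z ≠ 0)
    {P : Measure ((N : ℕ) → EuclideanSpace ℂ (Fin (nN N)))} [IsProbabilityMeasure P]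
    (hP : ∀ N, P.map (fun ω => ω N) = gammaC (nN N)) {L : ℝ}
    (hexp : Tendsto (fun N : ℕ => (N : ℝ)⁻¹ * ∫ c : EuclideanSpace ℂ (Fin (nN N)),
      ((∑ j, c j • p N j).roots.map F).sum ∂(gammaC (nN N))) atTop (𝓝 L)) :
    ∀ᵐ ω ∂P, Tendsto (fun N : ℕ => (N : ℝ)⁻¹ * ((∑ j, ω N j • p N j).roots.map F).sum)
      atTop (𝓝 L) := by
  have hprob : ∀ N, IsProbabilityMeasure (gammaC (nN N)) := fun N => by
    rw [← hP N]
    exact Measure.isProbabilityMeasure_map (measurable_pi_apply N).aemeasurable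
  set A : ENNReal := ∫⁻ z, ‖G z‖ₑ with hA
  set B : ENNReal := ∫⁻ z, ENNReal.ofReal (Real.log ‖z‖ ^ 2) ∂gaussC with hB
  have hAtop : A ≠ ⊤ :=
    (h.continuous.integrable_of_hasCompactSupport h.hasCompactSupport).hasFiniteIntegral.ne
  have hBtop : B ≠ ⊤ := lintegral_log_sq_gaussC_lt_top.ne
  choose κ V hVm hV hX hdev using fun N => h.exists_deviation_bound (hbase N)
  set X : (N : ℕ) → EuclideanSpace ℂ (Fin (nN N)) → ℝ :=
    fun N c => ((∑ j, c j • p N j).roots.map F).sum with hXdef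
  -- the expectations deviate from the constants by a bounded amount
  have hmean : ∀ N, ‖∫ c, X N c ∂(gammaC (nN N)) - κ N‖ₑ ≤ A + B * A := by
    intro N
    have hle : ∫⁻ c, ‖X N c - κ N‖ₑ ∂(gammaC (nN N)) ≤ A + B * A := by
      calc ∫⁻ c, ‖X N c - κ N‖ₑ ∂(gammaC (nN N))
          ≤ ∫⁻ c, (A + V N c) ∂(gammaC (nN N)) := by
            refine lintegral_mono fun c => ?_
            simpa using hdev N c 1 one_pos
        _ = A + ∫⁻ c, V N c ∂(gammaC (nN N)) := by
            rw [lintegral_add_left (by fun_prop)]; simp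
        _ ≤ _ := by gcongr; exact hV N
    have hi : Integrable (fun c => X N c - κ N) (gammaC (nN N)) :=
      ⟨((hX N).sub stronglyMeasurable_const).aestronglyMeasurable,
        hle.trans_lt (by finiteness)⟩
    have hi' : Integrable (X N) (gammaC (nN N)) := by
      exact (hi.add (integrable_const (κ N))).congr (Eventually.of_forall fun c => by simp)
    refine le_trans ?_ hle
    refine le_trans (le_of_eq ?_) (enorm_integral_le_lintegral_enorm _)
    rw [integral_sub hi' (integrable_const _)]
    simp
  have hκ : Tendsto (fun N : ℕ => (N : ℝ)⁻¹ * κ N) atTop (𝓝 L) := by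
    have h0 : Tendsto (fun N : ℕ => (N : ℝ)⁻¹ * (∫ c, X N c ∂(gammaC (nN N)) - κ N))
        atTop (𝓝 0) := by
      have hb : ∀ N : ℕ, ‖(N : ℝ)⁻¹ * (∫ c, X N c ∂(gammaC (nN N)) - κ N)‖ ≤
          (N : ℝ)⁻¹ * (A + B * A).toReal := by
        intro N
        rw [norm_mul, norm_inv, RCLike.norm_natCast]
        gcongr
        rw [← toReal_enorm]
        exact ENNReal.toReal_mono (by finiteness) (hmean N)
      refine squeeze_zero_norm hb ?_
      simpa using tendsto_inv_atTop_nhds_zero_nat.mul_const (A + B * A).toReal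
    have := hexp.sub h0
    simp only [sub_zero] at this
    refine this.congr fun N => ?_
    simp only [hXdef]
    ring
  -- Borel–Cantelli for the deviations
  have hsum : Summable fun N : ℕ => ((N : ℝ) ^ (3 / 2 : ℝ))⁻¹ :=
    Real.summable_nat_rpow_inv.2 (by norm_num)
  have hfin : ∫⁻ ω, ∑' N : ℕ, ENNReal.ofReal ((N : ℝ) ^ (3 / 2 : ℝ))⁻¹ * V N (ω N) ∂P ≠ ⊤ := by
    have hVm' : ∀ N, Measurable fun ω : (N : ℕ) → EuclideanSpace ℂ (Fin (nN N)) => V N (ω N) :=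
      fun N => (hVm N).comp (measurable_pi_apply N)
    rw [lintegral_tsum fun N => ((hVm' N).const_mul _).aemeasurable]
    refine ne_top_of_le_ne_top (b := (∑' N : ℕ, ENNReal.ofReal ((N : ℝ) ^ (3 / 2 : ℝ))⁻¹) *
      (B * A)) (ENNReal.mul_ne_top hsum.tsum_ofReal_ne_top (by finiteness)) ?_
    rw [← ENNReal.tsum_mul_right]
    refine ENNReal.tsum_le_tsum fun N => ?_
    rw [lintegral_const_mul _ (hVm' N)]
    gcongr
    rw [← lintegral_map (hVm N) (measurable_pi_apply N), hP N]
    exact hV N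
  have hmeas : Measurable fun ω : (N : ℕ) → EuclideanSpace ℂ (Fin (nN N)) =>
      ∑' N : ℕ, ENNReal.ofReal ((N : ℝ) ^ (3 / 2 : ℝ))⁻¹ * V N (ω N) :=
    Measurable.tsum fun N => ((hVm N).comp (measurable_pi_apply N)).const_mul _
  filter_upwards [ae_lt_top hmeas hfin] with ω hω
  have hV0 := ENNReal.tendsto_atTop_zero_of_tsum_ne_top hω.ne
  have hsq : Tendsto (fun N : ℕ => ENNReal.ofReal ((N : ℝ) ^ (1 / 2 : ℝ))⁻¹ * A) atTop (𝓝 0) := by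
    have h1 : Tendsto (fun N : ℕ => ((N : ℝ) ^ (1 / 2 : ℝ))⁻¹) atTop (𝓝 0) :=
      ((tendsto_rpow_atTop (by norm_num)).comp tendsto_natCast_atTop_atTop).inv_tendsto_atTop
    have h2 := ENNReal.Tendsto.mul_const (ENNReal.tendsto_ofReal h1) (Or.inr hAtop)
    simpa using h2
  have hdiff : Tendsto (fun N : ℕ => (N : ℝ)⁻¹ * (X N (ω N) - κ N)) atTop (𝓝 0) := by
    rw [tendsto_zero_iff_enorm_tendsto_zero]
    refine tendsto_of_tendsto_of_tendsto_of_le_of_le' tendsto_const_nhds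
      (by simpa only [add_zero] using hsq.add hV0) (Eventually.of_forall fun _ => zero_le) ?_
    filter_upwards [eventually_gt_atTop 0] with N hN
    have hN' : (0 : ℝ) < N := by exact_mod_cast hN
    have hd := hdev N (ω N) ((N : ℝ) ^ (1 / 2 : ℝ)) (by positivity)
    have e : ‖(N : ℝ)⁻¹‖ₑ = ENNReal.ofReal (N : ℝ)⁻¹ := Real.enorm_of_nonneg (by positivity)
    rw [enorm_mul, e]
    refine (mul_le_mul_right hd _).trans (le_of_eq ?_)
    rw [mul_add, ← mul_assoc, ← mul_assoc, ← ENNReal.ofReal_mul (by positivity),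
      ← ENNReal.ofReal_mul (by positivity)]
    have e1 : (N : ℝ)⁻¹ * (N : ℝ) ^ (1 / 2 : ℝ) = ((N : ℝ) ^ (1 / 2 : ℝ))⁻¹ := by
      rw [← Real.rpow_neg_one, ← Real.rpow_neg hN'.le, ← Real.rpow_add hN']
      norm_num
    have e2 : (N : ℝ)⁻¹ * ((N : ℝ) ^ (1 / 2 : ℝ))⁻¹ = ((N : ℝ) ^ (3 / 2 : ℝ))⁻¹ := by
      rw [← Real.rpow_neg_one, ← Real.rpow_neg hN'.le, ← Real.rpow_neg hN'.le,
        ← Real.rpow_add hN']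
      norm_num
    rw [e1, e2]
  have := hdiff.add hκ
  simp only [zero_add] at this
  refine this.congr fun N => ?_
  simp only [hXdef]
  ring

lemma tsupport_subset_cthickening_of_ball {X : Type*} [PseudoMetricSpace X] {f F : X → ℝ} {r : ℝ}
    (hF : ∀ a, (∀ x ∈ Metric.closedBall a r, f x = 0) → F a = 0) :
    tsupport F ⊆ Metric.cthickening r (tsupport f) := by
  refine closure_minimal (fun a ha => ?_) Metric.isClosed_cthickening
  by_contra h
  refine ha (hF a fun x hx => image_eq_zero_of_notMem_tsupport fun hx' => h ?_)
  exact Metric.mem_cthickening_of_dist_le a x r _ hx' (by rw [dist_comm]; exact hx)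

lemma exists_tent_bound {f : ℂ → ℝ} (hf : Continuous f) (hfs : HasCompactSupport f) (R : ℝ) :
    ∃ g : ℂ → ℝ, Continuous g ∧ HasCompactSupport g ∧
      ∀ z w : ℂ, ‖w‖ ≤ R → |f (z - w)| ≤ g z := by
  obtain ⟨C, hC⟩ := hf.bounded_above_of_compact_support hfs
  obtain ⟨M, hM⟩ := hfs.isBounded.subset_closedBall (0 : ℂ)
  have hC0 : 0 ≤ C := (norm_nonneg _).trans (hC 0)
  refine ⟨fun z => C * max 0 (M + R + 1 - ‖z‖), by fun_prop, ?_, fun z w hw => ?_⟩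
  · refine HasCompactSupport.intro (isCompact_closedBall (0 : ℂ) (M + R + 1)) fun z hz => ?_
    rw [mem_closedBall_zero_iff, not_le] at hz
    rw [max_eq_left (by linarith), mul_zero]
  · by_cases h : z - w ∈ tsupport f
    · have h1 := mem_closedBall_zero_iff.1 (hM h)
      have h2 : ‖z‖ ≤ ‖z - w‖ + ‖w‖ := by simpa using norm_add_le (z - w) w
      have h3 : 1 ≤ max 0 (M + R + 1 - ‖z‖) := le_max_of_le_right (by linarith)
      have := hC (z - w)
      rw [Real.norm_eq_abs] at this
      nlinarith
    · rw [image_eq_zero_of_notMem_tsupport h, abs_zero]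
      positivity

lemma integral_mul_circleAverage {k f : ℂ → ℝ} (hkm : Measurable k)
    (hk : ∀ g : ℂ → ℝ, Continuous g → HasCompactSupport g → ∀ a,
      Integrable fun z => k (z - a) * g z)
    (hf : Continuous f) (hfs : HasCompactSupport f) (a : ℂ) (R : ℝ) :
    ∫ z, k (z - a) * Real.circleAverage (fun w => f (z - w)) 0 R =
      ∫ t, Real.circleAverage (fun w => k (w - t)) 0 R * f (a - t) := by
  set μ : Measure ℝ := volume.restrict (Set.Ioc 0 (2 * Real.pi)) with hμ
  have hw : Continuous (circleMap 0 R) := continuous_circleMap 0 R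
  obtain ⟨g, hg, hgs, hgf⟩ := exists_tent_bound hf hfs |R|
  have hH' : Integrable (fun x : ℝ × ℂ => k (x.2 - a) * f (x.2 - circleMap 0 R x.1))
      (μ.prod volume) := by
    refine Integrable.mono ((integrable_const (1 : ℝ)).mul_prod (hk g hg hgs a)) ?_ ?_
    · exact Measurable.aestronglyMeasurable (by fun_prop)
    · filter_upwards with x
      rw [norm_mul, one_mul, norm_mul]
      gcongr
      exact (hgf x.2 _ (by simp)).trans (le_abs_self _)
  have hsub : ∀ (h : ℂ → ℝ) (w : ℂ), ∫ t, h (a - t + w) = ∫ z, h z := by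
    intro h w
    exact (integral_sub_left_eq_self (fun z => h (z + w)) volume a).trans
      (integral_add_right_eq_self _ _)
  have hH : Integrable (fun x : ℝ × ℂ => k (circleMap 0 R x.1 - x.2) * f (a - x.2))
      (μ.prod volume) := by
    rw [integrable_prod_iff (Measurable.aestronglyMeasurable (by fun_prop))]
    constructor
    · filter_upwards with θ
      have h1 := (hk _ (hf.comp (continuous_sub_right (circleMap 0 R θ)))
        (hfs.comp_homeomorph (Homeomorph.subRight (circleMap 0 R θ))) a)
      have h2 := (h1.comp_add_right (circleMap 0 R θ)).comp_sub_left a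
      refine h2.congr (Eventually.of_forall fun t => ?_)
      simp only [Function.comp_apply]
      congr 2 <;> ring
    · refine hH'.integral_norm_prod_left.congr (Eventually.of_forall fun θ => ?_)
      simp only
      rw [← hsub _ (circleMap 0 R θ)]
      refine integral_congr_ae (Eventually.of_forall fun t => ?_)
      simp only
      congr 3 <;> ring
  simp only [Real.circleAverage_def, smul_eq_mul,
    intervalIntegral.integral_of_le Real.two_pi_pos.le]
  have e1 : ∀ z, k (z - a) * ((2 * Real.pi)⁻¹ * ∫ θ, f (z - circleMap 0 R θ) ∂μ) =
      (2 * Real.pi)⁻¹ * ∫ θ, k (z - a) * f (z - circleMap 0 R θ) ∂μ := by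
    intro z
    rw [integral_const_mul]
    ring
  have e2 : ∀ t, ((2 * Real.pi)⁻¹ * ∫ θ, k (circleMap 0 R θ - t) ∂μ) * f (a - t) =
      (2 * Real.pi)⁻¹ * ∫ θ, k (circleMap 0 R θ - t) * f (a - t) ∂μ := by
    intro z
    rw [integral_mul_const]
    ring
  simp only [← hμ, e1, e2]
  rw [integral_const_mul, integral_const_mul]
  congr 1
  rw [← integral_integral_swap (μ := μ) (ν := volume)
    (f := fun θ z => k (z - a) * f (z - circleMap 0 R θ)) hH',
    ← integral_integral_swap (μ := μ) (ν := volume)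
    (f := fun θ t => k (circleMap 0 R θ - t) * f (a - t)) hH]
  refine integral_congr_ae (Eventually.of_forall fun θ => ?_)
  simp only
  rw [← hsub _ (circleMap 0 R θ)]
  refine integral_congr_ae (Eventually.of_forall fun t => ?_)
  simp only
  congr 2 <;> ring

lemma continuous_circleAverage_sub {f : ℂ → ℝ} (hf : Continuous f) (R : ℝ) :
    Continuous fun z => Real.circleAverage (fun w => f (z - w)) 0 R := by
  have h := intervalIntegral.continuous_parametric_intervalIntegral_of_continuous' (μ := volume)
    (f := fun (z : ℂ) (θ : ℝ) => f (z - circleMap 0 R θ)) (by fun_prop) 0 (2 * Real.pi)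
  simp only [Real.circleAverage_def, smul_eq_mul]
  exact continuous_const.mul h

lemma circleAverage_sub_eq_zero {f : ℂ → ℝ} {r R : ℝ} (hR : |R| ≤ r) {z : ℂ}
    (h : ∀ x ∈ Metric.closedBall z r, f x = 0) :
    Real.circleAverage (fun w => f (z - w)) 0 R = 0 := by
  rw [Real.circleAverage_congr_sphere (f₂ := fun _ => (0 : ℝ)), Real.circleAverage_const]
  intro w hw
  refine h _ ?_
  have hw' : ‖w‖ = |R| := by simpa using hw
  simpa [hw', dist_eq_norm] using hR

/-- The difference of the averages of `log ‖· - x‖` over two circles centred at the origin, as an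
explicit function of `s = ‖x‖ / r`, where `r` and `r / 2` are the radii. -/
noncomputable def logTent (s : ℝ) : ℝ := Real.log 2 + Real.posLog s - Real.posLog (2 * s)

lemma logTent_nonneg (s : ℝ) : 0 ≤ logTent s := by
  have h := Real.posLog_nat_mul (n := 2) (x := s)
  rw [logTent]
  push_cast at h
  linarith

lemma logTent_eq_zero {s : ℝ} (hs : 1 ≤ s) : logTent s = 0 := by
  rw [logTent, Real.posLog_eq_log (by rwa [abs_of_nonneg (by linarith)]),
    Real.posLog_eq_log (by rw [abs_of_nonneg (by linarith)]; linarith),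
    Real.log_mul two_ne_zero (by linarith)]
  ring

lemma continuous_logTent : Continuous logTent := by
  unfold logTent
  fun_prop

lemma circleAverage_log_sub_circleAverage_log {r : ℝ} (hr : 0 < r) (x : ℂ) :
    Real.circleAverage (fun w => Real.log ‖w - x‖) 0 r -
      Real.circleAverage (fun w => Real.log ‖w - x‖) 0 (r / 2) = logTent (r⁻¹ * ‖x‖) := by
  rw [circleAverage_log_norm_sub_const_eq_log_radius_add_posLog hr.ne',
    circleAverage_log_norm_sub_const_eq_log_radius_add_posLog (by positivity), logTent,
    Real.log_div hr.ne' two_ne_zero, zero_sub, norm_neg,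
    show (r / 2)⁻¹ * ‖x‖ = 2 * (r⁻¹ * ‖x‖) by field_simp]
  ring

open scoped ContDiff in
lemma exists_isLogPotential {f : ℂ → ℝ} (hf : ContDiff ℝ ∞ f) (hfs : HasCompactSupport f) {r : ℝ}
    (hr : 0 < r) :
    ∃ F G : ℂ → ℝ, IsLogPotential F G ∧ ContDiff ℝ ∞ F ∧
      tsupport F ⊆ Metric.cthickening r (tsupport f) ∧
      tsupport G ⊆ Metric.cthickening r (tsupport f) ∧
      ∀ a δ, 0 ≤ δ → (∀ x ∈ Metric.ball a r, dist (f x) (f a) ≤ δ) → dist (F a) (f a) ≤ δ := by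
  have hfc := hf.continuous
  set T : ℂ → ℝ := fun x => logTent (r⁻¹ * ‖x‖) with hT
  have hTc : Continuous T := continuous_logTent.comp (by fun_prop)
  have hT0 : ∀ x, r ≤ ‖x‖ → T x = 0 := fun x hx =>
    logTent_eq_zero (by rw [inv_mul_eq_div, one_le_div hr]; exact hx)
  have hTs : HasCompactSupport T :=
    HasCompactSupport.intro (isCompact_closedBall (0 : ℂ) r) fun x hx =>
      hT0 x (by rw [mem_closedBall_zero_iff, not_le] at hx; exact hx.le)
  have hT1 : T 0 ≠ 0 := by
    have : Real.log 2 ≠ 0 := (Real.log_pos one_lt_two).ne'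
    simpa only [hT, logTent, norm_zero, mul_zero, Real.posLog_zero, add_zero, sub_zero] using this
  set m : ℝ := ∫ x, T x with hm
  have hmpos : 0 < m := hTc.integral_pos_of_hasCompactSupport_nonneg_nonzero hTs
    (fun x => logTent_nonneg _) hT1
  set K : ℂ → ℝ := fun x => m⁻¹ * T x with hK
  have hKint : ∫ x, K x = 1 := by
    rw [integral_const_mul, ← hm, inv_mul_cancel₀ hmpos.ne']
  set F : ℂ → ℝ := convolution K f (ContinuousLinearMap.lsmul ℝ ℝ) volume with hF
  have hKc : Continuous K := continuous_const.mul hTc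
  have hFdist : ∀ a z₀ δ, 0 ≤ δ → (∀ x ∈ Metric.ball a r, dist (f x) z₀ ≤ δ) →
      dist (F a) z₀ ≤ δ := by
    intro a z₀ δ hδ h
    refine dist_convolution_le hδ ?_ (fun x => mul_nonneg (inv_nonneg.2 hmpos.le)
      (logTent_nonneg _)) hKint hfc.aestronglyMeasurable h
    intro x hx
    rw [mem_ball_zero_iff]
    by_contra hx'
    exact hx (by simp [hK, hT0 x (not_lt.1 hx')])
  set S : ℝ → ℂ → ℝ := fun R z => Real.circleAverage (fun w => f (z - w)) 0 R with hS
  have hSc : ∀ R, Continuous (S R) := continuous_circleAverage_sub hfc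
  have hS0 : ∀ R, |R| ≤ r → tsupport (S R) ⊆ Metric.cthickening r (tsupport f) := fun R hR =>
    tsupport_subset_cthickening_of_ball fun a h => circleAverage_sub_eq_zero hR h
  have hr1 : |r| ≤ r := (abs_of_pos hr).le
  have hr2 : |r / 2| ≤ r := by rw [abs_of_pos (by positivity)]; linarith
  have hcpt : IsCompact (Metric.cthickening r (tsupport f)) := hfs.isCompact.cthickening
  have hSs : ∀ R, |R| ≤ r → HasCompactSupport (S R) := fun R hR =>
    hcpt.of_isClosed_subset (isClosed_tsupport _) (hS0 R hR)
  have hG0 : tsupport (fun z => m⁻¹ * (S r z - S (r / 2) z)) ⊆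
      Metric.cthickening r (tsupport f) := by
    refine tsupport_subset_cthickening_of_ball fun a h => ?_
    have h1 : S r a = 0 := circleAverage_sub_eq_zero hr1 h
    have h2 : S (r / 2) a = 0 := circleAverage_sub_eq_zero hr2 h
    simp [h1, h2]
  refine ⟨F, fun z => m⁻¹ * (S r z - S (r / 2) z), ⟨?_, ?_, ?_, ?_⟩, ?_, ?_, hG0, ?_⟩
  · have := hSc r
    have := hSc (r / 2)
    fun_prop
  · exact hcpt.of_isClosed_subset (isClosed_tsupport _) hG0
  · have key : ∀ R, |R| ≤ r → ∫ z, S R z = ∫ t, f (0 - t) := by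
      intro R _
      simpa [Real.circleAverage_const] using
        integral_mul_circleAverage (k := fun _ => 1) measurable_const
        (fun g hg hgs a => by simpa using hg.integrable_of_hasCompactSupport hgs) hfc hfs 0 R
    rw [integral_const_mul, integral_sub
      ((hSc r).integrable_of_hasCompactSupport (hSs r hr1))
      ((hSc (r / 2)).integrable_of_hasCompactSupport (hSs _ hr2)), key r hr1, key _ hr2]
    simp
  · intro a
    have key : ∀ R, ∫ z, Real.log ‖z - a‖ * S R z =
        ∫ t, Real.circleAverage (fun w => Real.log ‖w - t‖) 0 R * f (a - t) := fun R =>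
      integral_mul_circleAverage (k := fun z => Real.log ‖z‖) (by fun_prop)
        (fun g hg hgs a => integrable_log_norm_sub_mul hg hgs a) hfc hfs a R
    have hint : ∀ R, R ≠ 0 → Integrable fun t =>
        Real.circleAverage (fun w => Real.log ‖w - t‖) 0 R * f (a - t) := by
      intro R hR
      refine Continuous.integrable_of_hasCompactSupport ?_
        (hfs.comp_homeomorph (Homeomorph.subLeft a)).mul_left
      simp_rw [circleAverage_log_norm_sub_const_eq_log_radius_add_posLog hR]
      fun_prop
    have e : ∀ z, Real.log ‖z - a‖ * (m⁻¹ * (S r z - S (r / 2) z)) =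
        m⁻¹ * (Real.log ‖z - a‖ * S r z - Real.log ‖z - a‖ * S (r / 2) z) := fun z => by ring
    simp_rw [e]
    rw [integral_const_mul, integral_sub
      (integrable_log_norm_sub_mul (hSc r) (hSs r hr1) a)
      (integrable_log_norm_sub_mul (hSc (r / 2)) (hSs _ hr2) a), key, key,
      ← integral_sub (hint _ hr.ne') (hint _ (by positivity)), ← integral_const_mul, hF,
      convolution_def]
    refine integral_congr_ae (Eventually.of_forall fun t => ?_)
    simp only [ContinuousLinearMap.lsmul_apply, smul_eq_mul, hK, hT]
    rw [← circleAverage_log_sub_circleAverage_log hr]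
    ring
  · exact hfs.contDiff_convolution_right _ hKc.locallyIntegrable hf
  · refine tsupport_subset_cthickening_of_ball fun a h => ?_
    have := hFdist a 0 0 le_rfl fun x hx => by simp [h x (Metric.ball_subset_closedBall hx)]
    simpa using this
  · exact fun a δ hδ h => hFdist a (f a) δ hδ h

open scoped ContDiff in
lemma exists_isLogPotential_dist_le {U : Set ℂ} (hU : IsOpen U) {φ : ℂ → ℝ} (hφ : Continuous φ)
    (hφs : HasCompactSupport φ) (hφU : tsupport φ ⊆ U) :
    ∃ K ⊆ U, IsCompact K ∧ tsupport φ ⊆ K ∧ ∀ ε > 0, ∃ F G : ℂ → ℝ, IsLogPotential F G ∧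
      ContDiff ℝ ∞ F ∧ tsupport F ⊆ K ∧ tsupport G ⊆ K ∧ ∀ x, dist (F x) (φ x) ≤ ε := by
  obtain ⟨ρ, hρ, hρU⟩ := hφs.isCompact.exists_cthickening_subset_open hU hφU
  refine ⟨_, hρU, hφs.isCompact.cthickening, Metric.self_subset_cthickening _, fun ε hε => ?_⟩
  have step : ∀ g : ℂ → ℝ, Continuous g → HasCompactSupport g → ∃ δ > 0, δ ≤ ρ / 2 ∧
      ∀ a, ∀ x ∈ Metric.ball a δ, dist (g x) (g a) ≤ ε / 2 := by
    intro g hg hgs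
    obtain ⟨δ, hδ, h⟩ := Metric.uniformContinuous_iff.1
      (hgs.uniformContinuous_of_continuous hg) (ε / 2) (half_pos hε)
    exact ⟨min δ (ρ / 2), lt_min hδ (half_pos hρ), min_le_right _ _, fun a x hx =>
      (h ((Metric.mem_ball.1 hx).trans_le (min_le_left _ _))).le⟩
  obtain ⟨δ, hδ, hδρ, hδφ⟩ := step φ hφ hφs
  obtain ⟨f, hf, hfd⟩ := hφ.exists_contDiff_dist_le_of_forall_mem_ball_dist_le hδ
  have hf0 : tsupport f ⊆ Metric.cthickening δ (tsupport φ) := by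
    refine tsupport_subset_cthickening_of_ball fun a h => ?_
    have h0 : φ a = 0 := h a (Metric.mem_closedBall_self hδ.le)
    have := hfd a 0 fun x hx => by simp [h x (Metric.ball_subset_closedBall hx), h0]
    rw [h0] at this
    simpa using this
  have hfs : HasCompactSupport f :=
    hφs.isCompact.cthickening.of_isClosed_subset (isClosed_tsupport _) hf0
  obtain ⟨r, hr, hrρ, hrf⟩ := step f hf.continuous hfs
  obtain ⟨F, G, hFG, hF, hFs, hGs, hFd⟩ := exists_isLogPotential hf hfs hr
  have hsub : Metric.cthickening r (tsupport f) ⊆ Metric.cthickening ρ (tsupport φ) := by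
    refine (Metric.cthickening_subset_of_subset r hf0).trans ?_
    refine (Metric.cthickening_cthickening_subset hr.le hδ.le _).trans ?_
    exact Metric.cthickening_mono (by linarith) _
  refine ⟨F, G, hFG, hF, hFs.trans hsub, hGs.trans hsub, fun x => ?_⟩
  calc dist (F x) (φ x) ≤ dist (F x) (f x) + dist (f x) (φ x) := dist_triangle _ _ _
    _ ≤ ε / 2 + ε / 2 := add_le_add (hFd x _ (half_pos hε).le (hrf x)) (hfd x _ (hδφ x))
    _ = ε := add_halves ε

open scoped ContDiff in
lemma exists_countable_isLogPotential_dense {U : Set ℂ} (hU : IsOpen U) :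
    ∃ D : Set C(ℂ, ℝ), D.Countable ∧
      (∀ F ∈ D, ContDiff ℝ ∞ F ∧ HasCompactSupport F ∧ tsupport F ⊆ U ∧
        ∃ G, IsLogPotential F G ∧ tsupport G ⊆ U) ∧
      ∀ φ : ℂ → ℝ, Continuous φ → HasCompactSupport φ → tsupport φ ⊆ U →
        ∃ K ⊆ U, IsCompact K ∧ tsupport φ ⊆ K ∧
          ∀ ε > 0, ∃ F ∈ D, tsupport F ⊆ K ∧ ∀ x, dist (F x) (φ x) ≤ ε := by
  have : LocallyCompactSpace U := hU.locallyCompactSpace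
  set E : ℕ → Set ℂ := fun m => Subtype.val '' (CompactExhaustion.choice U m) with hE
  have hEc : ∀ m, IsCompact (E m) := fun m =>
    ((CompactExhaustion.choice U).isCompact m).image continuous_subtype_val
  have hEU : ∀ m, E m ⊆ U := fun m => by
    rintro _ ⟨x, -, rfl⟩
    exact x.2
  set S : ℕ → Set C(ℂ, ℝ) := fun m => {F | ContDiff ℝ ∞ F ∧ tsupport F ⊆ E m ∧
    ∃ G, IsLogPotential F G ∧ tsupport G ⊆ U} with hS
  have hsep : ∀ m, ∃ t ⊆ S m, t.Countable ∧ S m ⊆ closure t := fun m =>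
    (TopologicalSpace.IsSeparable.of_separableSpace (S m)).exists_countable_dense_subset
  choose D hDS hDc hDd using hsep
  refine ⟨⋃ m, D m, Set.countable_iUnion hDc, fun F hF => ?_, fun φ hφ hφs hφU => ?_⟩
  · obtain ⟨m, hm⟩ := Set.mem_iUnion.1 hF
    obtain ⟨h1, h2, h3⟩ := hDS m hm
    exact ⟨h1, (hEc m).of_isClosed_subset (isClosed_tsupport _) h2, h2.trans (hEU m), h3⟩
  · obtain ⟨K, hKU, hK, hφK, happ⟩ := exists_isLogPotential_dist_le hU hφ hφs hφU
    obtain ⟨m, hm⟩ : ∃ m, K ⊆ E m := by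
      have hK' : IsCompact (Subtype.val ⁻¹' K : Set U) :=
        Topology.IsInducing.subtypeVal.isCompact_preimage_iff (by simpa using hKU) |>.2 hK
      obtain ⟨m, hm⟩ := (CompactExhaustion.choice U).exists_superset_of_isCompact hK'
      exact ⟨m, fun x hx => ⟨⟨x, hKU hx⟩, hm hx, rfl⟩⟩
    refine ⟨E m, hEU m, hEc m, hφK.trans hm, fun ε hε => ?_⟩
    obtain ⟨F₀, G, hFG, hF₀, hF₀s, hGs, hd⟩ := happ (ε / 2) (half_pos hε)
    have hmem : (⟨F₀, hF₀.continuous⟩ : C(ℂ, ℝ)) ∈ closure (D m) :=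
      hDd m ⟨hF₀, hF₀s.trans hm, G, hFG, hGs.trans hKU⟩
    rw [mem_closure_iff_nhds_basis
      (nhds_basis_uniformity Metric.uniformity_basis_dist.compactConvergenceUniformity)] at hmem
    obtain ⟨F, hF, hFd⟩ := hmem (E m, ε / 2) ⟨hEc m, half_pos hε⟩
    refine ⟨F, Set.mem_iUnion.2 ⟨m, hF⟩, (hDS m hF).2.1, fun x => ?_⟩
    have hFx : dist (F x) (F₀ x) ≤ ε / 2 := by
      by_cases hx : x ∈ E m
      · exact (hFd x hx).le
      · rw [image_eq_zero_of_notMem_tsupport fun h => hx ((hDS m hF).2.1 h),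
          image_eq_zero_of_notMem_tsupport fun h => hx (hm (hF₀s h)), dist_self]
        positivity
    linarith [dist_triangle (F x) (F₀ x) (φ x), hd x]

lemma dist_sum_map_le {α : Type*} (s : Multiset α) {f g : α → ℝ} {ε : ℝ}
    (h : ∀ x, dist (f x) (g x) ≤ ε) :
    dist (s.map f).sum (s.map g).sum ≤ s.card * ε := by
  induction s using Multiset.induction with
  | empty => simp
  | cons a s ih =>
    simp only [Multiset.map_cons, Multiset.sum_cons, Multiset.card_cons]
    refine (dist_add_add_le _ _ _ _).trans ?_
    push_cast
    linarith [h a]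

lemma dist_setIntegral_le {U K : Set ℂ} (hU : MeasurableSet U) (hKU : K ⊆ U) {ψ : Measure ℂ}
    (hK : IsCompact K) (hψ : ψ K < ⊤) {f g : ℂ → ℝ} (hf : Continuous f) (hg : Continuous g)
    (hfK : tsupport f ⊆ K) (hgK : tsupport g ⊆ K) {ε : ℝ} (h : ∀ x, dist (f x) (g x) ≤ ε) :
    dist (∫ z in U, f z ∂ψ) (∫ z in U, g z ∂ψ) ≤ ε * ψ.real K := by
  have hres : ∀ k : ℂ → ℝ, tsupport k ⊆ K → ∫ z in U, k z ∂ψ = ∫ z in K, k z ∂ψ := fun k hk =>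
    setIntegral_eq_of_subset_of_forall_sdiff_eq_zero hU hKU fun x hx =>
      image_eq_zero_of_notMem_tsupport fun h => hx.2 (hk h)
  have hint : ∀ k : ℂ → ℝ, Continuous k → IntegrableOn k K ψ := fun k hk => by
    obtain ⟨C, hC⟩ := hK.exists_bound_of_continuousOn hk.continuousOn
    exact Measure.integrableOn_of_bounded (M := C) hψ.ne hk.aestronglyMeasurable
      ((ae_restrict_iff' hK.measurableSet).2 (Eventually.of_forall hC))
  rw [hres f hfK, hres g hgK, dist_eq_norm, ← integral_sub (hint f hf) (hint g hg)]
  refine norm_setIntegral_le_of_norm_le_const hψ fun x _ => ?_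
  rw [← dist_eq_norm]
  exact h x

/-- Almost sure convergence of normalized zero measures (one-variable Corollary 1.3):
if `P` is the product of the Gaussian measures `γ_{n_N}` (characterized by its values
on cylinder sets), the polynomials `p_{N,1},…,p_{N,n_N}` have degree at most `N` and no
common zero in the open set `U`, and the normalized expected zero statistics converge
to `∫_U φ dψ` for every smooth `φ` compactly supported in `U`, then for `P`-almost
every sequence of coefficients the normalized zero statistics converge to `∫_U φ dψ`
for every continuous `φ` compactly supported in `U`. -/
theorem zeros_converge_almost_surely (U : Set ℂ) (hU : IsOpen U)
    (nN : ℕ → ℕ) (hnN : ∀ N, 1 ≤ nN N)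
    (p : (N : ℕ) → Fin (nN N) → Polynomial ℂ)
    (hdeg : ∀ N j, (p N j).natDegree ≤ N)
    (hbase : ∀ N, ∀ z ∈ U, ∃ j, (p N j).eval z ≠ 0)
    (P : Measure ((N : ℕ) → EuclideanSpace ℂ (Fin (nN N))))
    [IsProbabilityMeasure P]
    (hP : ∀ (s : Finset ℕ) (A : (N : ℕ) → Set (EuclideanSpace ℂ (Fin (nN N)))),
      (∀ N ∈ s, MeasurableSet (A N)) →
      P {ω | ∀ N ∈ s, ω N ∈ A N} = ∏ N ∈ s, gammaC (nN N) (A N))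
    (ψ : Measure ℂ) (hψ : ∀ K : Set ℂ, K ⊆ U → IsCompact K → ψ K < ⊤)
    (hexp : ∀ φ : ℂ → ℝ, ContDiff ℝ (⊤ : ℕ∞) φ → HasCompactSupport φ → tsupport φ ⊆ U →
      Filter.Tendsto
        (fun N : ℕ => (N : ℝ)⁻¹ *
          ∫ c : EuclideanSpace ℂ (Fin (nN N)),
            ((∑ j, c j • p N j).roots.map φ).sum ∂(gammaC (nN N)))
        Filter.atTop (nhds (∫ z in U, φ z ∂ψ))) :
    ∀ᵐ ω ∂P, ∀ φ : ℂ → ℝ, Continuous φ → HasCompactSupport φ → tsupport φ ⊆ U →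
      Filter.Tendsto
        (fun N : ℕ => (N : ℝ)⁻¹ * ((∑ j, ω N j • p N j).roots.map φ).sum)
        Filter.atTop (nhds (∫ z in U, φ z ∂ψ)) := by
  have hmarg : ∀ N, P.map (fun ω => ω N) = gammaC (nN N) := by
    intro N
    ext A hA
    have h := hP {N} (Function.update (fun _ => Set.univ) N A) (by simpa using hA)
    rw [Measure.map_apply (measurable_pi_apply N) hA]
    change P {ω | ω N ∈ A} = _
    simpa using h
  obtain ⟨D, hDc, hD, hdense⟩ := exists_countable_isLogPotential_dense hU
  have hae : ∀ᵐ ω ∂P, ∀ F ∈ D, Filter.Tendsto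
      (fun N : ℕ => (N : ℝ)⁻¹ * ((∑ j, ω N j • p N j).roots.map F).sum)
      Filter.atTop (nhds (∫ z in U, F z ∂ψ)) := by
    rw [ae_ball_iff hDc]
    intro F hF
    obtain ⟨hFc, hFs, hFU, G, hFG, hGU⟩ := hD F hF
    exact hFG.ae_tendsto (fun N z hz => hbase N z (hGU hz)) hmarg (hexp F hFc hFs hFU)
  filter_upwards [hae] with ω hω φ hφ hφs hφU
  obtain ⟨K, hKU, hK, hφK, happ⟩ := hdense φ hφ hφs hφU
  have hψK := hψ K hKU hK
  rw [Metric.tendsto_atTop]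
  intro ε hε
  have hm : 0 < 2 + ψ.real K := by positivity
  obtain ⟨F, hF, hFK, hFφ⟩ := happ (ε / (2 + ψ.real K) / 2) (by positivity)
  set η : ℝ := ε / (2 + ψ.real K) / 2 with hη
  have hη0 : 0 < η := by positivity
  have hηε : ε = 2 * (2 + ψ.real K) * η := by rw [hη]; field_simp
  obtain ⟨N₀, hN₀⟩ := Metric.tendsto_atTop.1 (hω F hF) η hη0
  refine ⟨N₀, fun N hN => ?_⟩
  have h1 := hN₀ N hN
  have h2 := dist_setIntegral_le hU.measurableSet hKU hK hψK F.continuous hφ hFK hφK hFφ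
  have h3 : dist ((N : ℝ)⁻¹ * ((∑ j, ω N j • p N j).roots.map F).sum)
      ((N : ℝ)⁻¹ * ((∑ j, ω N j • p N j).roots.map φ).sum) ≤ η := by
    have hcard : (∑ j, ω N j • p N j).roots.card ≤ N :=
      (Polynomial.card_roots' _).trans (Polynomial.natDegree_sum_le_of_forall_le _ _ fun j _ =>
        (Polynomial.natDegree_smul_le _ _).trans (hdeg N j))
    have hs := dist_sum_map_le (∑ j, ω N j • p N j).roots hFφ
    rw [Real.dist_eq] at hs ⊢
    rw [← mul_sub, abs_mul, abs_of_nonneg (by positivity : (0 : ℝ) ≤ (N : ℝ)⁻¹)]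
    calc _ ≤ (N : ℝ)⁻¹ * (N * η) := by
          gcongr
          exact hs.trans (by gcongr)
      _ ≤ η := by
          rw [← mul_assoc]
          exact mul_le_of_le_one_left hη0.le inv_mul_le_one
  rw [dist_comm] at h3
  have h4 := dist_triangle4 ((N : ℝ)⁻¹ * ((∑ j, ω N j • p N j).roots.map φ).sum)
    ((N : ℝ)⁻¹ * ((∑ j, ω N j • p N j).roots.map F).sum) (∫ z in U, F z ∂ψ) (∫ z in U, φ z ∂ψ)
  have h5 : 0 ≤ ψ.real K := measureReal_nonneg
  nlinarith
end
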